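/- arXiv:2311.04719 — 4 statements merged into one kernel-verified Lean document; each statement's English description precedes it below -/
import Mathlib

section
/- With notation as above, for each n ≥ 0: ir_M(I^{n+1}M) = ir_{R⋉M}(J^{n+1}) if and only if M/I^{n+1}M is a faithful R/I^{n+1}-module. -/
open TrivSqZeroExt IsLocalRing


open TrivSqZeroExt

/-- The ideal `I × N` of the idealization `R ⋉ M` (a homogeneous ideal), for an ideal `I`
of `R` and a submodule `N` of `M` with `I M ⊆ N`. -/
def idealProd {R M : Type*} [CommRing R] [AddCommGroup M] [Module R M] [Module Rᵐᵒᵖ M]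
    [IsCentralScalar R M] (I : Ideal R) (N : Submodule R M)
    (h : ∀ a ∈ I, ∀ m : M, a • m ∈ N) : Ideal (TrivSqZeroExt R M) where
  carrier := {x | x.fst ∈ I ∧ x.snd ∈ N}
  zero_mem' := ⟨I.zero_mem, N.zero_mem⟩
  add_mem' := fun ha hb => ⟨I.add_mem ha.1 hb.1, N.add_mem ha.2 hb.2⟩
  smul_mem' := fun c x hx => by
    refine ⟨I.mul_mem_left c.fst hx.1, ?_⟩
    show (c * x).snd ∈ N
    rw [snd_mul, op_smul_eq_smul]
    exact N.add_mem (N.smul_mem _ hx.2) (h x.fst hx.1 c.snd)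

/-- The colon submodule `N :_M I = {m ∈ M : I m ⊆ N}`. -/
def modColon {R M : Type*} [CommRing R] [AddCommGroup M] [Module R M]
    (N : Submodule R M) (I : Ideal R) : Submodule R M where
  carrier := {m | ∀ r ∈ I, r • m ∈ N}
  zero_mem' := fun r _ => by simp
  add_mem' := fun ha hb r hr => by
    rw [smul_add]; exact N.add_mem (ha r hr) (hb r hr)
  smul_mem' := fun c m hm r hr => by
    rw [smul_comm]; exact N.smul_mem c (hm r hr)

/-- The length of an `R`-module `M`: the Krull dimension of its lattice of submodules,
i.e. the supremum of the lengths of chains of submodules of `M`. -/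
noncomputable def moduleLength (R M : Type*) [CommRing R] [AddCommGroup M] [Module R M] :
    WithBot ℕ∞ :=
  Order.krullDim (Submodule R M)

/-- The index of reducibility of a submodule `N ⊆ M` of finite colength over the local ring
`(R, 𝔪)`: the length `ℓ_R((N :_M 𝔪)/N)` of the socle of `M/N`. -/
noncomputable def indexOfReducibility {R M : Type*} [CommRing R] [IsLocalRing R]
    [AddCommGroup M] [Module R M] (N : Submodule R M) : WithBot ℕ∞ :=
  moduleLength R ((modColon N (maximalIdeal R)).map N.mkQ)

instance tszeIsLocalRing {R M : Type*} [CommRing R] [IsLocalRing R] [AddCommGroup M]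
    [Module R M] [Module Rᵐᵒᵖ M] [IsCentralScalar R M] :
    IsLocalRing (TrivSqZeroExt R M) := by
  haveI : Nontrivial (TrivSqZeroExt R M) :=
    ⟨⟨0, 1, fun h => zero_ne_one (congrArg TrivSqZeroExt.fst h)⟩⟩
  refine IsLocalRing.of_isUnit_or_isUnit_of_isUnit_add (fun {a b} h => ?_)
  have hf : IsUnit (a.fst + b.fst) := by
    have := h.map (TrivSqZeroExt.fstHom R R M)
    simpa using this
  rcases IsLocalRing.isUnit_or_isUnit_of_isUnit_add hf with h' | h'
  · left
    rcases h'.nonempty_invertible with ⟨inv⟩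
    letI := inv
    letI := TrivSqZeroExt.invertibleOfInvertibleFst a
    exact isUnit_of_invertible a
  · right
    rcases h'.nonempty_invertible with ⟨inv⟩
    letI := inv
    letI := TrivSqZeroExt.invertibleOfInvertibleFst b
    exact isUnit_of_invertible b

/-- If every element of `S` acts on `Q` elementwise through `R`, the lengths over `R` and `S` agree. -/
theorem Module.length_restrictScalars_eq {R S Q : Type*} [CommRing R] [CommRing S] [Algebra R S]
    [AddCommGroup Q] [Module R Q] [Module S Q] [IsScalarTower R S Q]
    (h : ∀ (s : S) (q : Q), ∃ r : R, s • q = r • q) :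
    Module.length R Q = Module.length S Q := by
  let e : Submodule S Q ≃o Submodule R Q :=
    { toFun := fun N => N.restrictScalars R
      invFun := fun N =>
        { N with
          smul_mem' := fun s q hq => by
            obtain ⟨r, hr⟩ := h s q
            rw [hr]
            exact N.smul_mem r hq }
      left_inv := fun _ => rfl
      right_inv := fun _ => rfl
      map_rel_iff' := Iff.rfl }
  apply WithBot.coe_injective
  rw [Module.coe_length, Module.coe_length, Order.krullDim_eq_of_orderIso e]

theorem LinearMap.length_eq_iff_surjective_of_injective {R N P : Type*} [CommRing R]
    [AddCommGroup N] [Module R N] [AddCommGroup P] [Module R P] (f : N →ₗ[R] P)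
    (hf : Function.Injective f) (hN : Module.length R N ≠ ⊤) :
    Module.length R N = Module.length R P ↔ Function.Surjective f := by
  rw [Module.length_eq_add_of_exact f (LinearMap.range f).mkQ hf
    (Submodule.mkQ_surjective _) (LinearMap.exact_map_mkQ_range f), eq_comm,
    ← LinearMap.range_eq_top,
    ← Submodule.Quotient.subsingleton_iff, ← Module.length_eq_zero_iff (R := R)]
  exact ⟨fun h => by simpa using ENat.add_right_injective_of_ne_top hN (h.trans (add_zero _).symm),
    fun h => by rw [h, add_zero]⟩

theorem Module.length_ne_top_of_maximalIdeal_smul {R N : Type*} [CommRing R] [IsLocalRing R]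
    [AddCommGroup N] [Module R N] [Module.Finite R N]
    (h : ∀ r ∈ maximalIdeal R, ∀ x : N, r • x = 0) : Module.length R N ≠ ⊤ := by
  have ht : Module.IsTorsionBySet R N (maximalIdeal R) := fun x r => h r r.2 x
  let _ := ht.module
  have : IsScalarTower R (R ⧸ maximalIdeal R) N := ht.isScalarTower
  let _ := Ideal.Quotient.field (maximalIdeal R)
  have : Module.Finite (R ⧸ maximalIdeal R) N := Module.Finite.of_restrictScalars_finite R _ N
  rw [Module.length_eq_of_surjective (R := R ⧸ maximalIdeal R)
    (Ideal.Quotient.mk_surjective (I := maximalIdeal R))]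
  exact Module.length_ne_top

/-- If `K` contains a power of `m`, then `C ≤ K` as soon as `C ⊓ (K : m) ≤ K`. -/
theorem Ideal.le_of_inf_socle_le {R : Type*} [CommRing R] {m C K : Ideal R}
    (hm : ∃ k : ℕ, m ^ k ≤ K) (h : ∀ a ∈ C, (∀ r ∈ m, r * a ∈ K) → a ∈ K) : C ≤ K := by
  obtain ⟨k, hk⟩ := hm
  have key : ∀ j : ℕ, ∀ a ∈ C, (∀ r ∈ m ^ j, r * a ∈ K) → a ∈ K := by
    intro j
    induction j with
    | zero => intro a _ h0; simpa using h0 1 (by simp)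
    | succ j ih =>
      intro a ha hj
      refine ih a ha fun r hr => h _ (C.mul_mem_left r ha) fun s hs => ?_
      rw [← mul_assoc]
      exact hj _ (by rw [pow_succ']; exact Ideal.mul_mem_mul hs hr)
  exact fun a ha => key k a ha fun r hr => K.mul_mem_right a (hk hr)

/-- `(I × IM) ^ (n + 1) = I ^ (n + 1) × I ^ (n + 1) M`. -/
theorem mem_idealProd_pow_iff {R M : Type*} [CommRing R] [AddCommGroup M] [Module R M]
    [Module Rᵐᵒᵖ M] [IsCentralScalar R M] (I : Ideal R) (n : ℕ) (x : TrivSqZeroExt R M) :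
    x ∈ idealProd I (I • (⊤ : Submodule R M))
        (fun _ ha _ => Submodule.smul_mem_smul ha trivial) ^ (n + 1) ↔
      x.fst ∈ I ^ (n + 1) ∧ x.snd ∈ I ^ (n + 1) • (⊤ : Submodule R M) := by
  set J := idealProd I (I • (⊤ : Submodule R M))
        (fun _ ha _ => Submodule.smul_mem_smul ha trivial) with hJ
  constructor
  · intro hx
    induction n generalizing x with
    | zero =>
      rw [zero_add, pow_one] at hx ⊢
      exact hx
    | succ n ih =>
      rw [pow_succ] at hx
      refine Submodule.mul_induction_on hx (fun a ha b hb => ?_) fun a b ha hb =>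
        ⟨add_mem ha.1 hb.1, add_mem ha.2 hb.2⟩
      obtain ⟨ha1, ha2⟩ := ih a ha
      obtain ⟨hb1, hb2⟩ : b.fst ∈ I ∧ b.snd ∈ I • (⊤ : Submodule R M) := hb
      refine ⟨by rw [pow_succ, fst_mul]; exact Ideal.mul_mem_mul ha1 hb1, ?_⟩
      rw [snd_mul, op_smul_eq_smul]
      refine add_mem ?_ ?_
      · rw [pow_succ, Submodule.mul_smul]
        exact Submodule.smul_mem_smul ha1 hb2
      · rw [pow_succ', Submodule.mul_smul]
        exact Submodule.smul_mem_smul hb1 ha2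
  · have hmap : ∀ k, (I ^ k).map (inlHom R M) ≤ J ^ k := by
      intro k
      rw [Ideal.map_pow]
      refine Ideal.pow_right_mono (Ideal.map_le_iff_le_comap.2 fun a ha => ?_) k
      exact ⟨ha, by simp⟩
    rintro ⟨h1, h2⟩
    rw [← inl_fst_add_inr_snd_eq x]
    refine add_mem (hmap _ (Ideal.mem_map_of_mem (inlHom R M) h1)) ?_
    refine Submodule.smul_induction_on h2 (fun r hr m _ => ?_) fun a b ha hb => ?_
    · rw [pow_succ] at hr
      refine Submodule.mul_induction_on hr (fun a ha b hb => ?_) fun a b ha hb => ?_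
      · have : (inr ((a * b) • m) : TrivSqZeroExt R M) = inl a * inr (b • m) := by
          rw [inl_mul_inr, mul_smul]
        rw [this, pow_succ]
        exact Ideal.mul_mem_mul (hmap _ (Ideal.mem_map_of_mem (inlHom R M) ha))
          ⟨by simp, Submodule.smul_mem_smul hb Submodule.mem_top⟩
      · rw [add_smul, inr_add]; exact add_mem ha hb
    · rw [inr_add]; exact add_mem ha hb

/-- The colon of `K = I × N` by the maximal ideal of the idealization. -/
theorem mem_modColon_idealization_iff {R M : Type*} [CommRing R] [IsLocalRing R] [AddCommGroup M]
    [Module R M] [Module Rᵐᵒᵖ M] [IsCentralScalar R M] {I : Ideal R} {N : Submodule R M}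
    {K : Ideal (TrivSqZeroExt R M)} (hK : ∀ x, x ∈ K ↔ x.fst ∈ I ∧ x.snd ∈ N)
    (x : TrivSqZeroExt R M) :
    x ∈ modColon K (maximalIdeal (TrivSqZeroExt R M)) ↔
      (∀ r ∈ maximalIdeal R, r * x.fst ∈ I) ∧ (∀ m : M, x.fst • m ∈ N) ∧
        x.snd ∈ modColon N (maximalIdeal R) := by
  constructor
  · intro h
    have h1 : ∀ r ∈ maximalIdeal R, r * x.fst ∈ I ∧ r • x.snd ∈ N := fun r hr => by
      have := (hK _).1 (h (inl r) (by
        rw [mem_maximalIdeal, mem_nonunits_iff, isUnit_iff_isUnit_fst]; exact hr))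
      simpa using this
    refine ⟨fun r hr => (h1 r hr).1, fun m => ?_, fun r hr => (h1 r hr).2⟩
    have := (hK _).1 (h (inr m) (by
        rw [mem_maximalIdeal, mem_nonunits_iff, isUnit_iff_isUnit_fst]; simp))
    simpa using this.2
  · rintro ⟨h1, h2, h3⟩ s hs
    rw [mem_maximalIdeal, mem_nonunits_iff, isUnit_iff_isUnit_fst] at hs
    rw [hK, smul_eq_mul, fst_mul, snd_mul, op_smul_eq_smul]
    exact ⟨h1 _ hs, add_mem (h3 _ hs) (h2 _)⟩

theorem moduleLength_eq_coe_length (R M : Type*) [CommRing R] [AddCommGroup M] [Module R M] :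
    moduleLength R M = Module.length R M :=
  (Module.coe_length R M).symm

theorem indexOfReducibility_eq_idealization_iff {R M : Type*} [CommRing R] [IsNoetherianRing R]
    [IsLocalRing R] [AddCommGroup M] [Module R M] [Module Rᵐᵒᵖ M] [IsCentralScalar R M]
    [Module.Finite R M] {I : Ideal R} {N : Submodule R M}
    {K : Ideal (TrivSqZeroExt R M)} (hK : ∀ x, x ∈ K ↔ x.fst ∈ I ∧ x.snd ∈ N) :
    indexOfReducibility N = indexOfReducibility K ↔
      ∀ a : R, (∀ m : M, a • m ∈ N) → (∀ r ∈ maximalIdeal R, r * a ∈ I) → a ∈ I := by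
  set B := (modColon N (maximalIdeal R)).map N.mkQ
  set Q := (modColon K (maximalIdeal (TrivSqZeroExt R M))).map K.mkQ
  have hlen : Module.length R Q = Module.length (TrivSqZeroExt R M) Q := by
    refine Module.length_restrictScalars_eq fun s q => ⟨s.fst, ?_⟩
    obtain ⟨-, x, hx, rfl⟩ := q
    apply Subtype.ext
    change K.mkQ (s • x) = K.mkQ (s.fst • x)
    rw [← sub_eq_zero, ← map_sub, Submodule.mkQ_apply, Submodule.Quotient.mk_eq_zero, hK]
    have := ((mem_modColon_idealization_iff hK x).1 hx).2.1 s.snd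
    simpa using this
  have hBtop : Module.length R B ≠ ⊤ := by
    refine Module.length_ne_top_of_maximalIdeal_smul fun r hr b => ?_
    obtain ⟨-, x, hx, rfl⟩ := b
    apply Subtype.ext
    change N.mkQ (r • x) = 0
    rw [Submodule.mkQ_apply, Submodule.Quotient.mk_eq_zero]
    exact hx r hr
  let F : (M ⧸ N) →ₗ[R] (TrivSqZeroExt R M ⧸ K) :=
    N.liftQ ((K.mkQ.restrictScalars R) ∘ₗ inrHom R M) fun m hm => by
      exact (Submodule.Quotient.mk_eq_zero K).2 ((hK _).2 (by simpa using hm))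
  let f : B →ₗ[R] Q := (F.domRestrict B).codRestrict (Q.restrictScalars R) (by
    rintro ⟨-, x, hx, rfl⟩
    exact ⟨inr x, (mem_modColon_idealization_iff hK _).2 (by simpa using hx), rfl⟩)
  have hf : Function.Injective f := by
    rw [← LinearMap.ker_eq_bot, LinearMap.ker_eq_bot']
    rintro ⟨-, x, hx, rfl⟩ h
    have h' : K.mkQ (inr x) = 0 := congrArg Subtype.val h
    rw [Submodule.mkQ_apply, Submodule.Quotient.mk_eq_zero, hK] at h'
    apply Subtype.ext
    exact (Submodule.Quotient.mk_eq_zero N).2 (by simpa using h'.2)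
  have key : indexOfReducibility N = indexOfReducibility K ↔ Function.Surjective f := by
    rw [← f.length_eq_iff_surjective_of_injective hf hBtop, hlen, indexOfReducibility,
      indexOfReducibility, moduleLength_eq_coe_length, moduleLength_eq_coe_length]
    exact WithBot.coe_inj
  rw [key]
  constructor
  · intro hs a ha1 ha2
    have ha : (inl a : TrivSqZeroExt R M) ∈ modColon K (maximalIdeal (TrivSqZeroExt R M)) :=
      (mem_modColon_idealization_iff hK _).2 ⟨by simpa using ha2, by simpa using ha1, by simp⟩
    obtain ⟨⟨-, x, hx, rfl⟩, h⟩ := hs ⟨K.mkQ (inl a), Submodule.mem_map_of_mem ha⟩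
    have h' : K.mkQ (inr x) = K.mkQ (inl a) := congrArg Subtype.val h
    have h2 := (hK _).1 ((Submodule.Quotient.eq K).1 h')
    simpa using h2.1
  · rintro h ⟨-, x, hx, rfl⟩
    obtain ⟨h1, h2, h3⟩ := (mem_modColon_idealization_iff hK x).1 hx
    refine ⟨⟨N.mkQ x.snd, Submodule.mem_map_of_mem h3⟩, Subtype.ext ?_⟩
    change K.mkQ (inr x.snd) = K.mkQ x
    refine (Submodule.Quotient.eq K).2 ((hK _).2 ?_)
    simpa using h _ h2 h1

/-- `ir_M(I^(n+1)M) = ir_{R⋉M}(J^(n+1))` if and only if `M/I^(n+1)M` is a faithful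
`R/I^(n+1)`-module (equivalently, the `R`-annihilator of `M/I^(n+1)M` is `I^(n+1)`). -/
theorem ir_eq_ir_idealization_iff_faithful (R M : Type*) [CommRing R] [IsNoetherianRing R]
    [IsLocalRing R] [AddCommGroup M] [Module R M] [Module Rᵐᵒᵖ M] [IsCentralScalar R M]
    [Module.Finite R M] (hM : Nontrivial M) (I : Ideal R)
    (hI : I.IsPrimary ∧ I.radical = IsLocalRing.maximalIdeal R) (n : ℕ) :
    indexOfReducibility ((I ^ (n + 1)) • (⊤ : Submodule R M)) =
        indexOfReducibility
          ((idealProd I (I • (⊤ : Submodule R M))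
              (fun a ha m => Submodule.smul_mem_smul ha trivial) : Ideal (TrivSqZeroExt R M)) ^
            (n + 1) : Submodule (TrivSqZeroExt R M) (TrivSqZeroExt R M)) ↔
      Module.annihilator R (M ⧸ ((I ^ (n + 1)) • (⊤ : Submodule R M))) = I ^ (n + 1) := by
  rw [indexOfReducibility_eq_idealization_iff (mem_idealProd_pow_iff I n)]
  have hann : ∀ a : R, a ∈ Module.annihilator R (M ⧸ ((I ^ (n + 1)) • (⊤ : Submodule R M))) ↔
      ∀ m : M, a • m ∈ (I ^ (n + 1)) • (⊤ : Submodule R M) := fun a => by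
    rw [Submodule.annihilator_quotient, Submodule.mem_colon]
    simp
  constructor
  · intro h
    refine le_antisymm ?_ fun a ha => (hann a).2 fun m => Submodule.smul_mem_smul ha trivial
    refine Ideal.le_of_inf_socle_le (m := maximalIdeal R) ?_ fun a ha => h a ((hann a).1 ha)
    refine Ideal.exists_pow_le_of_le_radical_of_fg ?_ (IsNoetherian.noetherian _)
    rw [Ideal.radical_pow I n.succ_ne_zero, hI.2]
  · intro h a ha _
    rw [← h]
    exact (hann a).2 ha
end

section
/- With notation as above, for each n ≥ 0: ir_{R⋉M}(J^{n+1}) = ir_R(I^{n+1}) + ir_M(I^{n+1}M) if and only if (I^{n+1} :_R 𝔪)M = I^{n+1}M. -/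
open TrivSqZeroExt IsLocalRing


open TrivSqZeroExt

section LinearAlgebra

variable {R M N : Type*} [CommRing R] [AddCommGroup M] [Module R M] [AddCommGroup N] [Module R N]

lemma mem_modColon {A : Submodule R M} {I : Ideal R} {m : M} :
    m ∈ modColon A I ↔ ∀ r ∈ I, r • m ∈ A := Iff.rfl

lemma le_modColon (A : Submodule R M) (I : Ideal R) : A ≤ modColon A I :=
  fun _ hm r _ => A.smul_mem r hm

/-- A submodule of the form `A × B` is the product of the modules `A` and `B`. -/
def submoduleProdEquiv (A : Submodule R M) (B : Submodule R N) : A.prod B ≃ₗ[R] A × B where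
  toFun x := (⟨x.1.1, x.2.1⟩, ⟨x.1.2, x.2.2⟩)
  invFun x := ⟨(x.1.1, x.2.1), ⟨x.1.2, x.2.2⟩⟩
  map_add' _ _ := rfl
  map_smul' _ _ := rfl
  left_inv _ := rfl
  right_inv _ := rfl

lemma Submodule.eq_of_le_of_length_eq {A B : Submodule R M} [IsArtinian R B] [IsNoetherian R B]
    (hle : A ≤ B) (h : Module.length R A = Module.length R B) : A = B := by
  by_contra hne
  have htop : A.submoduleOf B ≠ ⊤ := fun ht =>
    hne (le_antisymm hle (Submodule.submoduleOf_eq_top.mp ht))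
  have hlt := Submodule.length_lt htop
  rw [(Submodule.submoduleOfEquivOfLe hle).length_eq, h] at hlt
  exact hlt.false

lemma isArtinian_of_isTorsionBySet (I : Ideal R) [I.IsMaximal] [Module.Finite R M]
    (h : Module.IsTorsionBySet R M I) : IsArtinian R M := by
  let := Ideal.Quotient.field I
  let := h.module
  have : IsScalarTower R (R ⧸ I) M := h.isScalarTower
  have : Module.Finite (R ⧸ I) M := Module.Finite.of_restrictScalars_finite R (R ⧸ I) M
  exact isArtinian_of_surjective_algebraMap (R := R ⧸ I) Ideal.Quotient.mk_surjective

/-- If `S` acts on `M` only through the scalars coming from `R`, the length of `M` over `S` and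
over `R` coincide. -/
lemma moduleLength_eq_of_smul {S : Type*} [CommRing S] [Algebra R S] [Module S M]
    [IsScalarTower R S M] (h : ∀ (s : S), ∃ r : R, ∀ m : M, s • m = r • m) :
    moduleLength S M = moduleLength R M := by
  refine Order.krullDim_eq_of_orderIso
    { toFun := Submodule.restrictScalars R
      invFun := fun A =>
        { carrier := A
          add_mem' := A.add_mem
          zero_mem' := A.zero_mem
          smul_mem' := fun s m hm => ?_ }
      left_inv := fun _ => rfl
      right_inv := fun _ => rfl
      map_rel_iff' := Iff.rfl }
  obtain ⟨r, hr⟩ := h s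
  rw [hr]
  exact A.smul_mem r hm

lemma length_map_mkQ_of_ker_eq {A B : Submodule R M} {f : M →ₗ[R] N}
    (hf : LinearMap.ker f = A) :
    Module.length R (B.map A.mkQ) = Module.length R (B.map f) := by
  have hinj : Function.Injective (A.liftQ f hf.ge) :=
    LinearMap.ker_eq_bot.mp (Submodule.ker_liftQ_eq_bot _ _ _ hf.le)
  rw [(Submodule.equivMapOfInjective _ hinj _).length_eq, ← Submodule.map_comp,
    Submodule.liftQ_mkQ]

end LinearAlgebra

section IndexOfReducibility

variable {R M : Type*} [CommRing R] [IsLocalRing R] [AddCommGroup M] [Module R M]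

lemma indexOfReducibility_eq_length (A : Submodule R M) :
    indexOfReducibility A =
      Module.length R ((modColon A (maximalIdeal R)).map A.mkQ) :=
  (Module.coe_length _ _).symm

lemma isTorsionBySet_socle (A : Submodule R M) :
    Module.IsTorsionBySet R ((modColon A (maximalIdeal R)).map A.mkQ) (maximalIdeal R) := by
  rintro ⟨_, m, hm, rfl⟩ ⟨r, hr⟩
  refine Subtype.ext ?_
  show r • A.mkQ m = 0
  rw [← map_smul, Submodule.mkQ_apply, Submodule.Quotient.mk_eq_zero]
  exact hm r hr

lemma isArtinian_socle [IsNoetherian R M] (A : Submodule R M) :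
    IsArtinian R ((modColon A (maximalIdeal R)).map A.mkQ) :=
  isArtinian_of_isTorsionBySet _ (isTorsionBySet_socle A)

end IndexOfReducibility

section Idealization

variable {R M : Type*} [CommRing R] [AddCommGroup M] [Module R M] [Module Rᵐᵒᵖ M]
  [IsCentralScalar R M]

lemma mem_idealProd {I : Ideal R} {N : Submodule R M} {h : ∀ a ∈ I, ∀ m : M, a • m ∈ N}
    {x : TrivSqZeroExt R M} : x ∈ idealProd I N h ↔ x.fst ∈ I ∧ x.snd ∈ N := Iff.rfl

lemma idealProd_mul (I K : Ideal R)
    (hI : ∀ a ∈ I, ∀ m : M, a • m ∈ I • (⊤ : Submodule R M))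
    (hK : ∀ a ∈ K, ∀ m : M, a • m ∈ K • (⊤ : Submodule R M))
    (hIK : ∀ a ∈ K * I, ∀ m : M, a • m ∈ (K * I) • (⊤ : Submodule R M)) :
    idealProd K (K • (⊤ : Submodule R M)) hK * idealProd I (I • (⊤ : Submodule R M)) hI =
      idealProd (K * I) ((K * I) • (⊤ : Submodule R M)) hIK := by
  have hinl : ∀ {L : Ideal R} {hL : ∀ a ∈ L, ∀ m : M, a • m ∈ L • (⊤ : Submodule R M)} {a : R},
      a ∈ L → inl a ∈ idealProd L (L • (⊤ : Submodule R M)) hL := fun ha => by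
    simpa [mem_idealProd] using ha
  refine le_antisymm (Ideal.mul_le.mpr fun x hx y hy => ?_) fun x hx => ?_
  · refine ⟨Ideal.mul_mem_mul hx.1 hy.1, ?_⟩
    rw [snd_mul, op_smul_eq_smul, Submodule.mul_smul]
    refine add_mem (Submodule.smul_mem_smul hx.1 hy.2) ?_
    rw [← Submodule.mul_smul, mul_comm, Submodule.mul_smul]
    exact Submodule.smul_mem_smul hy.1 hx.2
  · have hfst : ∀ a ∈ K * I, (inl a : TrivSqZeroExt R M) ∈
        idealProd K (K • (⊤ : Submodule R M)) hK * idealProd I (I • (⊤ : Submodule R M)) hI := by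
      intro a ha
      refine Submodule.mul_induction_on ha (fun b hb c hc => ?_) fun b c hb hc => ?_
      · rw [inl_mul]
        exact Ideal.mul_mem_mul (hinl hb) (hinl hc)
      · rw [inl_add]
        exact add_mem hb hc
    have hsnd : ∀ m ∈ (K * I) • (⊤ : Submodule R M), (inr m : TrivSqZeroExt R M) ∈
        idealProd K (K • (⊤ : Submodule R M)) hK * idealProd I (I • (⊤ : Submodule R M)) hI := by
      intro m hm
      refine Submodule.smul_induction_on hm (fun a ha m _ => ?_) fun m m' hm hm' => ?_
      · rw [← inl_mul_inr]
        exact Ideal.mul_mem_right _ _ (hfst a ha)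
      · rw [inr_add]
        exact add_mem hm hm'
    rw [← inl_fst_add_inr_snd_eq x]
    exact add_mem (hfst _ hx.1) (hsnd _ hx.2)

lemma idealProd_pow (I : Ideal R) (n : ℕ)
    (hI : ∀ a ∈ I, ∀ m : M, a • m ∈ I • (⊤ : Submodule R M))
    (hIn : ∀ a ∈ I ^ (n + 1), ∀ m : M, a • m ∈ I ^ (n + 1) • (⊤ : Submodule R M)) :
    idealProd I (I • (⊤ : Submodule R M)) hI ^ (n + 1) =
      idealProd (I ^ (n + 1)) (I ^ (n + 1) • (⊤ : Submodule R M)) hIn := by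
  induction n with
  | zero =>
    ext x
    simp [mem_idealProd]
  | succ n ih =>
    rw [pow_succ, ih fun a ha m => Submodule.smul_mem_smul ha trivial,
      idealProd_mul I (I ^ (n + 1)) hI _ fun a ha m => Submodule.smul_mem_smul ha trivial]
    ext x
    simp only [mem_idealProd, pow_succ I (n + 1)]

/-- The canonical map `R ⋉ M → R / K × M / N`, with kernel `K × N`. -/
def mkQProd (K : Ideal R) (N : Submodule R M) :
    TrivSqZeroExt R M →ₗ[R] (R ⧸ K) × (M ⧸ N) :=
  (K.mkQ ∘ₗ (fstHom R R M).toLinearMap).prod (N.mkQ ∘ₗ sndHom R M)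

lemma ker_mkQProd {K : Ideal R} {N : Submodule R M} (hK : ∀ a ∈ K, ∀ m : M, a • m ∈ N) :
    LinearMap.ker (mkQProd K N) = (idealProd K N hK).restrictScalars R := by
  ext x
  simp [mkQProd, mem_idealProd, Ideal.Quotient.eq_zero_iff_mem]

variable [IsLocalRing R]

lemma mem_maximalIdeal_trivSqZeroExt {x : TrivSqZeroExt R M} :
    x ∈ maximalIdeal (TrivSqZeroExt R M) ↔ x.fst ∈ maximalIdeal R := by
  rw [mem_maximalIdeal, mem_maximalIdeal, mem_nonunits_iff, mem_nonunits_iff,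
    isUnit_iff_isUnit_fst]

lemma mem_modColon_idealProd {K : Ideal R} {N : Submodule R M}
    {hK : ∀ a ∈ K, ∀ m : M, a • m ∈ N} {x : TrivSqZeroExt R M} :
    x ∈ modColon (idealProd K N hK) (maximalIdeal (TrivSqZeroExt R M)) ↔
      x.fst ∈ modColon K (maximalIdeal R) ⊓ N.colon Set.univ ∧
        x.snd ∈ modColon N (maximalIdeal R) := by
  simp only [Submodule.mem_inf, mem_modColon, Submodule.mem_colon, mem_maximalIdeal_trivSqZeroExt,
    mem_idealProd, smul_eq_mul, fst_mul, snd_mul, op_smul_eq_smul, Set.mem_univ, true_imp_iff]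
  constructor
  · intro h
    refine ⟨⟨fun r hr => ?_, fun m => ?_⟩, fun r hr => ?_⟩
    · simpa using (h (inl r) (by simpa using hr)).1
    · simpa using (h (inr m) (by simp)).2
    · simpa using (h (inl r) (by simpa using hr)).2
  · rintro ⟨⟨h₁, h₂⟩, h₃⟩ r hr
    exact ⟨h₁ _ hr, add_mem (h₃ _ hr) (h₂ _)⟩

lemma map_mkQProd_modColon {K : Ideal R} {N : Submodule R M}
    (hK : ∀ a ∈ K, ∀ m : M, a • m ∈ N) :
    ((modColon (idealProd K N hK) (maximalIdeal (TrivSqZeroExt R M))).restrictScalars R).map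
        (mkQProd K N) =
      ((modColon K (maximalIdeal R) ⊓ N.colon Set.univ).map K.mkQ).prod
        ((modColon N (maximalIdeal R)).map N.mkQ) := by
  ext ⟨y, z⟩
  constructor
  · rintro ⟨x, hx, hxy⟩
    obtain ⟨h₁, h₂⟩ := mem_modColon_idealProd.mp hx
    rw [← hxy]
    exact ⟨⟨_, h₁, rfl⟩, ⟨_, h₂, rfl⟩⟩
  · rintro ⟨⟨a, ha, rfl⟩, ⟨m, hm, rfl⟩⟩
    refine ⟨inl a + inr m, mem_modColon_idealProd.mpr ?_, ?_⟩
    · simpa using ⟨ha, hm⟩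
    · simp [mkQProd]

/-- The index of reducibility of the homogeneous ideal `K × N` of `R ⋉ M` is the sum of the
length of `((K :_R 𝔪) ∩ (N :_R M)) / K` and the index of reducibility of `N`. -/
lemma indexOfReducibility_idealProd {K : Ideal R} {N : Submodule R M}
    (hK : ∀ a ∈ K, ∀ m : M, a • m ∈ N) :
    indexOfReducibility (idealProd K N hK) =
      (Module.length R ((modColon K (maximalIdeal R) ⊓ N.colon Set.univ).map K.mkQ) +
        Module.length R ((modColon N (maximalIdeal R)).map N.mkQ) : ℕ∞) := by
  rw [← Module.length_prod, ← (submoduleProdEquiv _ _).length_eq, ← map_mkQProd_modColon hK,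
    ← length_map_mkQ_of_ker_eq (ker_mkQProd hK), indexOfReducibility,
    moduleLength_eq_of_smul (R := R), Module.coe_length]
  · rfl
  · intro s
    refine ⟨s.fst, ?_⟩
    rintro ⟨_, x, hx, rfl⟩
    refine Subtype.ext ?_
    show (idealProd K N hK).mkQ (s • x) = (idealProd K N hK).mkQ (s.fst • x)
    have hsub : s • x - s.fst • x = (s - inl s.fst) • x := by
      ext <;> simp
    rw [← sub_eq_zero, ← map_sub, hsub, Submodule.mkQ_apply, Submodule.Quotient.mk_eq_zero]
    refine hx _ (mem_maximalIdeal_trivSqZeroExt.mpr ?_)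
    simp

lemma indexOfReducibility_idealProd_eq_add_iff [IsNoetherianRing R] [Module.Finite R M]
    {K : Ideal R} (hK : ∀ a ∈ K, ∀ m : M, a • m ∈ K • (⊤ : Submodule R M)) :
    indexOfReducibility (idealProd K (K • (⊤ : Submodule R M)) hK) =
        indexOfReducibility (K : Submodule R R) + indexOfReducibility (K • (⊤ : Submodule R M)) ↔
      Submodule.colon (K : Submodule R R) (maximalIdeal R : Submodule R R) •
        (⊤ : Submodule R M) = K • (⊤ : Submodule R M) := by
  have hcolon : Submodule.colon (K : Submodule R R) (maximalIdeal R : Submodule R R) =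
      modColon K (maximalIdeal R) := by
    ext a
    simp [Submodule.mem_colon, mem_modColon, mul_comm]
  have := isArtinian_socle (M := R) K
  have := isArtinian_socle (K • (⊤ : Submodule R M))
  have hle : K ≤ modColon K (maximalIdeal R) ⊓ (K • (⊤ : Submodule R M)).colon Set.univ :=
    le_inf (le_modColon _ _) fun a ha => Submodule.mem_colon.mpr fun m _ => hK a ha m
  have hsmul : (modColon K (maximalIdeal R) : Ideal R) • (⊤ : Submodule R M) =
      K • (⊤ : Submodule R M) ↔
      modColon K (maximalIdeal R) ≤ (K • (⊤ : Submodule R M)).colon Set.univ := by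
    rw [le_antisymm_iff, and_iff_left (Submodule.smul_mono_left (le_modColon _ _)),
      Submodule.smul_le]
    simp [SetLike.le_def, Submodule.mem_colon]
  rw [hcolon, hsmul, indexOfReducibility_idealProd, indexOfReducibility_eq_length,
    indexOfReducibility_eq_length, ← WithBot.coe_add, WithBot.coe_inj,
    (ENat.add_left_injective_of_ne_top Module.length_ne_top).eq_iff]
  constructor
  · intro h
    have heq := Submodule.eq_of_le_of_length_eq (Submodule.map_mono inf_le_left) h
    have hcomap := congrArg (Submodule.comap K.mkQ) heq
    rw [Submodule.comap_map_mkQ, Submodule.comap_map_mkQ, sup_eq_right.mpr hle,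
      sup_eq_right.mpr (le_modColon _ _)] at hcomap
    exact inf_eq_left.mp hcomap
  · intro h
    rw [inf_eq_left.mpr h]

end Idealization

/-- `ir_{R⋉M}(J^(n+1)) = ir_R(I^(n+1)) + ir_M(I^(n+1)M)` if and only if
`(I^(n+1) :_R 𝔪)M = I^(n+1)M`. -/
theorem ir_idealization_eq_sum_iff (R M : Type*) [CommRing R] [IsNoetherianRing R]
    [IsLocalRing R] [AddCommGroup M] [Module R M] [Module Rᵐᵒᵖ M] [IsCentralScalar R M]
    [Module.Finite R M] (hM : Nontrivial M) (I : Ideal R)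
    (hI : I.IsPrimary ∧ I.radical = IsLocalRing.maximalIdeal R) (n : ℕ) :
    indexOfReducibility
          ((idealProd I (I • (⊤ : Submodule R M))
              (fun a ha m => Submodule.smul_mem_smul ha trivial) : Ideal (TrivSqZeroExt R M)) ^
            (n + 1) : Submodule (TrivSqZeroExt R M) (TrivSqZeroExt R M)) =
        indexOfReducibility (I ^ (n + 1) : Submodule R R) +
          indexOfReducibility ((I ^ (n + 1)) • (⊤ : Submodule R M)) ↔
      (Submodule.colon (I ^ (n + 1) : Submodule R R)
            (IsLocalRing.maximalIdeal R : Submodule R R) : Ideal R) •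
          (⊤ : Submodule R M) =
        (I ^ (n + 1)) • (⊤ : Submodule R M) := by
  rw [← indexOfReducibility_idealProd_eq_add_iff
    (fun _ ha _ => Submodule.smul_mem_smul ha trivial), ← idealProd_pow]
end

section
/- Let (R, 𝔪) be Cohen-Macaulay, M a maximal Cohen-Macaulay R-module, Q a parameter ideal of R, and set R̄ = R/Q, M̄ = M/QM. Then r(R ⋉ M) = r_R(M) if and only if M̄ is a faithful R̄-module. -/
universe u

open TrivSqZeroExt IsLocalRing

open TrivSqZeroExt

/-- The Ext group `Ext_R^n(R/𝔪, M)` over a local ring `(R, 𝔪)`. -/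
noncomputable def extResidue (R M : Type u) [CommRing R] [IsLocalRing R] [AddCommGroup M]
    [Module R M] (n : ℕ) : ModuleCat.{u} R :=
  ((Ext R (ModuleCat.{u} R) n).obj
      (Opposite.op (ModuleCat.of R (IsLocalRing.ResidueField R)))).obj (ModuleCat.of R M)

/-- `dim_{R/𝔪} Ext_R^t(R/𝔪, M)`, computed as a length over `R`; for a Cohen-Macaulay module
`M` of depth `t` this is the (Cohen-Macaulay) type `r_R(M)`. -/
noncomputable def cmTypeAt (R M : Type u) [CommRing R] [IsLocalRing R] [AddCommGroup M]
    [Module R M] (t : ℕ) : WithBot ℕ∞ :=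
  moduleLength R (extResidue R M t)

/-- The depth of a module `M` over a local ring `(R, 𝔪)`:
`inf {n : Ext_R^n(R/𝔪, M) ≠ 0}`. -/
noncomputable def moduleDepth (R M : Type u) [CommRing R] [IsLocalRing R] [AddCommGroup M]
    [Module R M] : ℕ∞ :=
  sInf {n : ℕ∞ | ∃ i : ℕ, n = i ∧ Nontrivial (extResidue R M i)}

/-- `Q` is a parameter ideal of the `d`-dimensional local ring `R` (resp. of a
`d`-dimensional module) if it is generated by `d` elements and is `𝔪`-primary. -/
def IsParameterIdeal {R : Type u} [CommRing R] [IsLocalRing R] (Q : Ideal R) (d : ℕ) : Prop :=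
  ∃ s : Finset R, Q = Ideal.span (s : Set R) ∧ s.card = d ∧
    Q.radical = IsLocalRing.maximalIdeal R

open CategoryTheory Limits Pointwise

section Homological

variable {R : Type u} [CommRing R]

/-- The map `Hom(K, N) ⟶ Hom(K, N')` of cochain complexes induced by `f : N ⟶ N'`. -/
noncomputable def linearYonedaFunctor (K : ChainComplex (ModuleCat.{u} R) ℕ) :
    ModuleCat.{u} R ⥤ CochainComplex (ModuleCat.{u} R) ℕ where
  obj N := K.linearYonedaObj R N
  map {N N'} f :=
    { f := fun n => ((linearYoneda R (ModuleCat.{u} R)).map f).app (Opposite.op (K.X n))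
      comm' := fun i j _ => by
        ext g
        exact (Category.assoc (K.d j i) (show K.X i ⟶ N from g) f).symm }

instance (K : ChainComplex (ModuleCat.{u} R) ℕ) : (linearYonedaFunctor K).Additive where
  map_add {N N' f g} := by
    ext n x
    exact Preadditive.comp_add _ _ _ x f g

lemma linearYonedaFunctor_shortExact {k : ModuleCat.{u} R} (P : ProjectiveResolution k)
    {S : ShortComplex (ModuleCat.{u} R)} (hS : S.ShortExact) :
    (S.map (linearYonedaFunctor P.complex)).ShortExact := by
  apply HomologicalComplex.shortExact_of_degreewise_shortExact
  intro n
  have := hS.mono_f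
  have := hS.epi_g
  refine { exact := ?_, mono_f := ?_, epi_g := ?_ }
  · rw [ShortComplex.moduleCat_exact_iff]
    intro g hg
    exact ⟨hS.exact.lift g hg, hS.exact.lift_f g hg⟩
  · rw [ModuleCat.mono_iff_injective]
    intro g g' h
    exact (cancel_mono S.f).1 h
  · rw [ModuleCat.epi_iff_surjective]
    intro (g : P.complex.X n ⟶ S.X₃)
    exact ⟨Projective.factorThru g S.g, Projective.factorThru_comp g S.g⟩

lemma homologyMap_linearYonedaFunctor_smul {k : ModuleCat.{u} R} (P : ProjectiveResolution k)
    {x : R} (hx : x • 𝟙 k = 0) (N : ModuleCat.{u} R) (n : ℕ) :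
    HomologicalComplex.homologyMap ((linearYonedaFunctor P.complex).map (x • 𝟙 N)) n = 0 := by
  have h : Homotopy (x • 𝟙 P.complex) 0 := ProjectiveResolution.liftHomotopyZero _ (by
    apply HomologicalComplex.to_single_hom_ext
    rw [← cancel_mono (HomologicalComplex.singleObjXSelf (ComplexShape.down ℕ) 0 k).hom]
    have h0 : ∀ g : P.complex.X 0 ⟶ k, x • g = 0 := fun g => by
      rw [← Category.comp_id g, ← Linear.comp_smul, hx, comp_zero]
    refine Eq.trans ?_ zero_comp.symm
    refine Eq.trans ?_ (h0 (P.π.f 0))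
    simp
    rfl)
  have h2 := (((linearYoneda R (ModuleCat.{u} R)).obj N).rightOp.mapHomotopy h).unop
  have e : (linearYonedaFunctor P.complex).map (x • 𝟙 N) =
      (HomologicalComplex.unopFunctor _ _).map
        ((((linearYoneda R (ModuleCat.{u} R)).obj N).rightOp.mapHomologicalComplex _).map
          (x • 𝟙 P.complex)).op := by
    ext n (g : P.complex.X n ⟶ N)
    change g ≫ (x • 𝟙 N) = (x • 𝟙 (P.complex.X n)) ≫ g
    simp
  rw [e]
  refine (h2.homologyMap_eq n).trans ?_
  rw [Functor.map_zero, op_zero, Functor.map_zero]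
  exact HomologicalComplex.homologyMap_zero _ _ _

instance (N : ModuleCat.{u} R) : PreservesLimits ((linearYoneda R (ModuleCat.{u} R)).obj N) :=
  have : PreservesLimits ((linearYoneda R (ModuleCat.{u} R)).obj N ⋙ forget _) :=
    (inferInstance : PreservesLimits (yoneda.obj N))
  preservesLimits_of_reflects_of_preserves _ (forget _)

/-- `Ext⁰(k, N)` is isomorphic to `Hom(k, N)`. -/
noncomputable def extZeroIso (k N : ModuleCat.{u} R) :
    ((Ext R (ModuleCat.{u} R) 0).obj (Opposite.op k)).obj N ≅ ModuleCat.of R (k ⟶ N) :=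
  haveI := preservesFiniteColimits_rightOp ((linearYoneda R (ModuleCat.{u} R)).obj N)
  (((linearYoneda R (ModuleCat.{u} R)).obj N).rightOp.leftDerivedZeroIsoSelf.app k).unop.symm

lemma isZero_ext_zero_of_isSMulRegular {k N : ModuleCat.{u} R} {x : R} (hk : x • 𝟙 k = 0)
    (hx : IsSMulRegular N x) : IsZero (((Ext R (ModuleCat.{u} R) 0).obj (Opposite.op k)).obj N) := by
  refine IsZero.of_iso ?_ (extZeroIso k N)
  have : Subsingleton (k ⟶ N) := by
    refine subsingleton_of_forall_eq 0 fun f => ?_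
    have h : x • f = 0 := by rw [← Category.id_comp f, ← Linear.smul_comp, hk, zero_comp]
    ext y
    apply hx
    have := ConcreteCategory.congr_hom h y
    exact this.trans (smul_zero x).symm
  exact ModuleCat.isZero_of_subsingleton _

lemma isZero_ext_succ_of_isSMulRegular {k N : ModuleCat.{u} R} {x : R} (hk : x • 𝟙 k = 0)
    (hx : IsSMulRegular N x) {n : ℕ}
    (h : IsZero (((Ext R (ModuleCat.{u} R) n).obj (Opposite.op k)).obj (N.smulShortComplex x).X₃)) :
    IsZero (((Ext R (ModuleCat.{u} R) (n + 1)).obj (Opposite.op k)).obj N) := by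
  let P := projectiveResolution k
  have hS := linearYonedaFunctor_shortExact P hx.smulShortComplex_shortExact
  refine IsZero.of_iso ?_ (P.isoExt (n + 1) N)
  have : Epi (hS.δ n (n + 1) rfl) := (hS.homology_exact₁ n (n + 1) rfl).epi_f
    (homologyMap_linearYonedaFunctor_smul P hk N (n + 1))
  exact @IsZero.of_epi _ _ _ _ _ (hS.δ n (n + 1) rfl) this (h.of_iso (P.isoExt n _).symm)

lemma nonempty_ext_smulShortComplex_iso {k N : ModuleCat.{u} R} {x : R} (hk : x • 𝟙 k = 0)
    (hx : IsSMulRegular N x) {n : ℕ}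
    (h : IsZero (((Ext R (ModuleCat.{u} R) n).obj (Opposite.op k)).obj N)) :
    Nonempty (((Ext R (ModuleCat.{u} R) n).obj (Opposite.op k)).obj (N.smulShortComplex x).X₃ ≅
      ((Ext R (ModuleCat.{u} R) (n + 1)).obj (Opposite.op k)).obj N) := by
  let P := projectiveResolution k
  have hS := linearYonedaFunctor_shortExact P hx.smulShortComplex_shortExact
  have : Epi (hS.δ n (n + 1) rfl) := (hS.homology_exact₁ n (n + 1) rfl).epi_f
    (homologyMap_linearYonedaFunctor_smul P hk N (n + 1))
  have : Mono (hS.δ n (n + 1) rfl) := hS.mono_δ n (n + 1) rfl (h.of_iso (P.isoExt n N).symm)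
  have : IsIso (hS.δ n (n + 1) rfl) := isIso_of_mono_of_epi (hS.δ n (n + 1) rfl)
  exact ⟨P.isoExt n _ ≪≫ @asIso _ _ _ _ (hS.δ n (n + 1) rfl) this ≪≫ (P.isoExt (n + 1) N).symm⟩

lemma isZero_ext_smulShortComplex {k N : ModuleCat.{u} R} {x : R}
    (hx : IsSMulRegular N x) {n : ℕ}
    (h : IsZero (((Ext R (ModuleCat.{u} R) n).obj (Opposite.op k)).obj N))
    (h' : IsZero (((Ext R (ModuleCat.{u} R) (n + 1)).obj (Opposite.op k)).obj N)) :
    IsZero (((Ext R (ModuleCat.{u} R) n).obj (Opposite.op k)).obj (N.smulShortComplex x).X₃) := by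
  let P := projectiveResolution k
  have hS := linearYonedaFunctor_shortExact P hx.smulShortComplex_shortExact
  refine IsZero.of_iso ?_ (P.isoExt n _)
  exact (hS.homology_exact₃ n (n + 1) rfl).isZero_of_both_zeros
    ((h.of_iso (P.isoExt n N).symm).eq_of_src _ _)
    ((h'.of_iso (P.isoExt (n + 1) N).symm).eq_of_tgt _ _)

end Homological

section LocalRing

variable {R : Type u} [CommRing R] [IsLocalRing R]

lemma smul_id_residueField {x : R} (hx : x ∈ maximalIdeal R) :
    x • 𝟙 (ModuleCat.of R (ResidueField R)) = 0 := by
  ext y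
  obtain ⟨y, rfl⟩ := IsLocalRing.residue_surjective y
  change x • residue R y = 0
  rw [Algebra.smul_def]
  have : algebraMap R (ResidueField R) x = 0 := (residue_eq_zero_iff x).2 hx
  rw [this, zero_mul]

variable {N : Type u} [AddCommGroup N] [Module R N]

lemma subsingleton_extResidue_of_isWeaklyRegular {xs : List R}
    (hxs : ∀ x ∈ xs, x ∈ maximalIdeal R) (h : RingTheory.Sequence.IsWeaklyRegular N xs)
    {i : ℕ} (hi : i < xs.length) : Subsingleton (extResidue R N i) := by
  induction xs generalizing N i with
  | nil => simp at hi
  | cons x xs ih =>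
    obtain ⟨h1, h2⟩ := (RingTheory.Sequence.isWeaklyRegular_cons_iff N x xs).1 h
    rw [← ModuleCat.isZero_iff_subsingleton]
    obtain _ | i := i
    · exact isZero_ext_zero_of_isSMulRegular (smul_id_residueField (hxs x (by simp))) h1
    · exact isZero_ext_succ_of_isSMulRegular (N := ModuleCat.of R N)
        (smul_id_residueField (hxs x (by simp))) h1 <|
        ModuleCat.isZero_iff_subsingleton.2 <|
        ih (fun y hy => hxs y (by simp [hy])) h2 (by simpa using hi)

lemma nonempty_extResidue_equiv {xs : List R}
    (hxs : ∀ x ∈ xs, x ∈ maximalIdeal R) (h : RingTheory.Sequence.IsWeaklyRegular N xs) :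
    Nonempty (extResidue R N xs.length ≃ₗ[R]
      (ResidueField R →ₗ[R] N ⧸ (Ideal.ofList xs • (⊤ : Submodule R N)))) := by
  induction xs generalizing N with
  | nil =>
    refine ⟨(extZeroIso _ _).toLinearEquiv ≪≫ₗ ModuleCat.homLinearEquiv ≪≫ₗ
      (LinearEquiv.congrRight (Submodule.quotEquivOfEqBot _ ?_).symm)⟩
    simp
  | cons x xs ih =>
    obtain ⟨h1, h2⟩ := (RingTheory.Sequence.isWeaklyRegular_cons_iff N x xs).1 h
    obtain ⟨e⟩ := nonempty_ext_smulShortComplex_iso (N := ModuleCat.of R N) (n := xs.length)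
      (smul_id_residueField (hxs x (by simp))) h1 (ModuleCat.isZero_iff_subsingleton.2 <|
        subsingleton_extResidue_of_isWeaklyRegular hxs h (by simp))
    obtain ⟨e'⟩ := ih (fun y hy => hxs y (by simp [hy])) h2
    exact ⟨e.toLinearEquiv.symm ≪≫ₗ e' ≪≫ₗ LinearEquiv.congrRight
      (Submodule.quotOfListConsSMulTopEquivQuotSMulTopInner N x xs).symm⟩

lemma subsingleton_extResidue_of_lt_moduleDepth {i : ℕ} (hi : (i : ℕ∞) < moduleDepth R N) :
    Subsingleton (extResidue R N i) := by
  by_contra h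
  exact (notMem_of_lt_csInf hi (OrderBot.bddBelow _)) ⟨i, rfl, not_subsingleton_iff_nontrivial.1 h⟩

lemma subsingleton_extResidue_quotSMulTop {x : R} (hx : IsSMulRegular N x) {i : ℕ}
    (h : Subsingleton (extResidue R N i)) (h' : Subsingleton (extResidue R N (i + 1))) :
    Subsingleton (extResidue R (QuotSMulTop x N) i) := by
  rw [← ModuleCat.isZero_iff_subsingleton] at h h' ⊢
  exact isZero_ext_smulShortComplex (N := ModuleCat.of R N) hx h h'

lemma exists_isSMulRegular_of_subsingleton_extResidue_zero [IsNoetherianRing R]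
    [Module.Finite R N] (h : Subsingleton (extResidue R N 0)) :
    ∃ y ∈ maximalIdeal R, IsSMulRegular N y := by
  have : Subsingleton (ResidueField R →ₗ[R] N) :=
    ((extZeroIso (ModuleCat.of R (ResidueField R)) (ModuleCat.of R N)).toLinearEquiv ≪≫ₗ
      ModuleCat.homLinearEquiv).symm.toEquiv.subsingleton_congr.2 h
  obtain ⟨y, hy, hy'⟩ := IsSMulRegular.subsingleton_linearMap_iff.1 this
  refine ⟨y, ?_, hy'⟩
  have : Module.annihilator R (ResidueField R) = maximalIdeal R :=
    Ideal.annihilator_quotient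
  exact this ▸ hy

lemma ringKrullDim_quotient_add_one_le {A : Type*} [CommRing A] {p q : Ideal A} [p.IsPrime]
    (h : p < q) : ringKrullDim (A ⧸ q) + 1 ≤ ringKrullDim (A ⧸ p) := by
  obtain ⟨r, hrq, hrp⟩ := SetLike.exists_of_lt h
  refine ringKrullDim_succ_le_of_surjective (Ideal.Quotient.factor h.le)
    (Ideal.Quotient.factor_surjective h.le) (r := Ideal.Quotient.mk p r) ?_ ?_
  · rw [mem_nonZeroDivisors_iff_ne_zero]
    exact fun h => hrp (Ideal.Quotient.eq_zero_iff_mem.1 h)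
  · simpa using Ideal.Quotient.eq_zero_iff_mem.2 hrq

lemma exists_isAssociatedPrime_quotSMulTop_gt [IsNoetherianRing R] [Module.Finite R N] {y : R}
    (hy : y ∈ maximalIdeal R) (hyN : IsSMulRegular N y) {p : Ideal R}
    (hp : IsAssociatedPrime p N) : ∃ q, IsAssociatedPrime q (QuotSMulTop y N) ∧ p < q := by
  obtain ⟨hpp, w, hw⟩ := isAssociatedPrime_iff.1 hp
  have hyp : y ∉ p := by
    rw [hw, Submodule.mem_colon_singleton, Submodule.mem_bot]
    intro h
    refine hpp.ne_top ?_
    rw [hw, hyN (h.trans (smul_zero y).symm)]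
    simp
  let K : Submodule R N := Submodule.torsionBySet R N p
  have hK : ∃ z ∈ K, z ∉ y • (⊤ : Submodule R N) := by
    by_contra! hK
    have hle : K ≤ maximalIdeal R • K := by
      intro z hz
      obtain ⟨z', -, rfl⟩ := (Submodule.mem_smul_pointwise_iff_exists _ _ _).1 (hK z hz)
      refine Submodule.smul_mem_smul hy ?_
      rw [Submodule.mem_torsionBySet_iff] at hz ⊢
      intro a
      refine hyN ?_
      have := hz a
      rw [smul_comm] at this
      exact this.trans (smul_zero y).symm
    have hbot : K = ⊥ := Submodule.eq_bot_of_le_smul_of_le_jacobson_bot (maximalIdeal R) K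
      (IsNoetherian.noetherian K) hle (IsLocalRing.maximalIdeal_le_jacobson _)
    have hwK : w ∈ K := by
      rw [Submodule.mem_torsionBySet_iff]
      rintro ⟨a, ha⟩
      rw [SetLike.mem_coe, hw, Submodule.mem_colon_singleton] at ha
      exact ha
    rw [hbot, Submodule.mem_bot] at hwK
    refine hpp.ne_top ?_
    rw [hw, hwK]
    simp
  obtain ⟨z, hz, hzy⟩ := hK
  obtain ⟨q, hq, hle⟩ := exists_le_isAssociatedPrime_of_isNoetherianRing R
    (Submodule.Quotient.mk z : QuotSMulTop y N)
    (fun h => hzy ((Submodule.Quotient.mk_eq_zero _).1 h))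
  refine ⟨q, hq, lt_of_le_of_ne (fun a ha => hle ?_) ?_⟩
  · rw [Submodule.mem_colon_singleton, Submodule.mem_bot, ← Submodule.Quotient.mk_smul,
      (Submodule.mem_torsionBySet_iff _ _).1 hz ⟨a, ha⟩, Submodule.Quotient.mk_zero]
  · rintro rfl
    refine hyp (hle ?_)
    rw [Submodule.mem_colon_singleton, Submodule.mem_bot, ← Submodule.Quotient.mk_smul]
    exact (Submodule.Quotient.mk_eq_zero _).2 (Submodule.smul_mem_pointwise_smul z y ⊤ trivial)

lemma le_ringKrullDim_quotient_of_isAssociatedPrime [IsNoetherianRing R] [Module.Finite R N]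
    {n : ℕ} (h : ∀ i < n, Subsingleton (extResidue R N i)) {p : Ideal R}
    (hp : IsAssociatedPrime p N) : (n : WithBot ℕ∞) ≤ ringKrullDim (R ⧸ p) := by
  induction n generalizing N p with
  | zero =>
    have := Ideal.Quotient.nontrivial_iff.2 hp.isPrime.ne_top
    simpa using ringKrullDim_nonneg_of_nontrivial
  | succ n ih =>
    obtain ⟨y, hy, hyN⟩ := exists_isSMulRegular_of_subsingleton_extResidue_zero (h 0 (by simp))
    obtain ⟨q, hq, hpq⟩ := exists_isAssociatedPrime_quotSMulTop_gt hy hyN hp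
    have := hp.isPrime
    refine le_trans ?_ (ringKrullDim_quotient_add_one_le hpq)
    rw [Nat.cast_add_one]
    gcongr
    exact ih (fun i hi => subsingleton_extResidue_quotSMulTop hyN (h i (by lia))
      (h (i + 1) (by lia))) hq

lemma ringKrullDim_quotient_le_length [IsNoetherianRing R] {p : Ideal R} [p.IsPrime] {xs : List R}
    (hxs : ∀ x ∈ xs, x ∈ maximalIdeal R)
    (h : ∀ q : Ideal R, q.IsPrime → p ≤ q → Ideal.ofList xs ≤ q → q = maximalIdeal R) :
    ringKrullDim (R ⧸ p) ≤ xs.length := by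
  classical
  let s : Finset (R ⧸ p) := (xs.map (Ideal.Quotient.mk p)).toFinset
  have hmem (x : R) (hx : x ∈ xs) : Ideal.Quotient.mk p x ∈ s := by
    simpa [s] using ⟨x, hx, rfl⟩
  have hcard : s.card ≤ xs.length := (List.toFinset_card_le _).trans (by simp)
  have : IsLocalRing (R ⧸ p) := .of_surjective' _ Ideal.Quotient.mk_surjective
  have hs : (s : Set (R ⧸ p)) ⊆ Ring.jacobson (R ⧸ p) := by
    intro z hz
    obtain ⟨x, hx, rfl⟩ : ∃ x ∈ xs, Ideal.Quotient.mk p x = z := by simpa [s] using hz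
    rw [IsLocalRing.ringJacobson_eq_maximalIdeal,
      ← IsLocalRing.map_maximalIdeal_of_surjective _ Ideal.Quotient.mk_surjective]
    exact Ideal.mem_map_of_mem _ (hxs x hx)
  have hzero : Ring.KrullDimLE 0 ((R ⧸ p) ⧸ Ideal.span (s : Set (R ⧸ p))) := by
    refine .mk₀ fun I hI => ?_
    let f : R →+* (R ⧸ p) ⧸ Ideal.span (s : Set (R ⧸ p)) :=
      (Ideal.Quotient.mk _).comp (Ideal.Quotient.mk p)
    have hf : Function.Surjective f :=
      Ideal.Quotient.mk_surjective.comp Ideal.Quotient.mk_surjective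
    have : I.comap f = maximalIdeal R := by
      refine h _ inferInstance (fun x hx => ?_) (Ideal.span_le.2 fun x hx => ?_)
      · simp [f, Ideal.mem_comap, Ideal.Quotient.eq_zero_iff_mem.2 hx]
      · have : f x = 0 := Ideal.Quotient.eq_zero_iff_mem.2 (Ideal.subset_span (hmem x hx))
        simp [this]
    have := Ideal.map_eq_top_or_isMaximal_of_surjective f hf (this ▸ maximalIdeal.isMaximal R)
    rw [Ideal.map_comap_of_surjective f hf] at this
    exact this.resolve_left hI.ne_top
  refine (ringKrullDim_le_ringKrullDim_quotient_add_card s hs).trans ?_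
  have h0 : ringKrullDim ((R ⧸ p) ⧸ Ideal.span (s : Set (R ⧸ p))) ≤ 0 := by
    simpa using Ring.krullDimLE_iff.1 hzero
  calc _ ≤ (0 : WithBot ℕ∞) + s.card := by gcongr
    _ ≤ xs.length := by simpa using hcard

lemma isWeaklyRegular_of_subsingleton_extResidue [IsNoetherianRing R] [Module.Finite R N]
    {xs : List R} (hxs : ∀ x ∈ xs, x ∈ maximalIdeal R)
    (h : ∀ q : Ideal R, q.IsPrime → Module.annihilator R N ≤ q → Ideal.ofList xs ≤ q →
      q = maximalIdeal R)
    (hN : ∀ i < xs.length, Subsingleton (extResidue R N i)) :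
    RingTheory.Sequence.IsWeaklyRegular N xs := by
  induction xs generalizing N with
  | nil => exact .nil R N
  | cons x xs ih =>
    have hx : IsSMulRegular N x := by
      by_contra hx
      have : x ∈ ⋃ p ∈ associatedPrimes R N, (p : Set R) := by
        rw [biUnion_associatedPrimes_eq_compl_regular]
        exact hx
      simp only [Set.mem_iUnion, SetLike.mem_coe, exists_prop] at this
      obtain ⟨p, hp, hxp⟩ := this
      have := hp.isPrime
      have h1 := le_ringKrullDim_quotient_of_isAssociatedPrime hN hp
      have h2 : ringKrullDim (R ⧸ p) ≤ xs.length := by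
        refine ringKrullDim_quotient_le_length (fun y hy => hxs y (by simp [hy]))
          fun q hq hpq hle => h q hq
            (Submodule.annihilator_top.ge.trans (hp.annihilator_le.trans hpq)) ?_
        rw [Ideal.ofList_cons, sup_le_iff]
        exact ⟨(Ideal.span_singleton_le_iff_mem _).2 (hpq hxp), hle⟩
      have := h1.trans h2
      norm_cast at this
      simp at this
    refine (RingTheory.Sequence.isWeaklyRegular_cons_iff N x xs).2
      ⟨hx, ih (fun y hy => hxs y (by simp [hy])) (fun q hq hle hle' => h q hq ?_ ?_)
        fun i hi => subsingleton_extResidue_quotSMulTop hx (hN i (by simp; lia))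
          (hN (i + 1) (by simpa using hi))⟩
    · exact (LinearMap.annihilator_le_of_surjective _
        (Submodule.mkQ_surjective (x • (⊤ : Submodule R N)))).trans hle
    · rw [Ideal.ofList_cons, sup_le_iff]
      refine ⟨(Ideal.span_singleton_le_iff_mem _).2 (hle ?_), hle'⟩
      rw [Module.mem_annihilator]
      intro z
      obtain ⟨z, rfl⟩ := Submodule.Quotient.mk_surjective _ z
      rw [← Submodule.Quotient.mk_smul]
      exact (Submodule.Quotient.mk_eq_zero _).2 (Submodule.smul_mem_pointwise_smul z x ⊤ trivial)

lemma nonempty_residueField_linearMap_equiv_torsionBySet :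
    Nonempty ((ResidueField R →ₗ[R] N) ≃ₗ[R] Submodule.torsionBySet R N (maximalIdeal R)) := by
  let e : (ResidueField R →ₗ[R] N) →ₗ[R] Submodule.torsionBySet R N (maximalIdeal R) :=
    LinearMap.codRestrict _ (LinearMap.applyₗ 1) fun f => by
      rw [Submodule.mem_torsionBySet_iff]
      rintro ⟨a, ha⟩
      have : a • (1 : ResidueField R) = 0 := by
        rw [Algebra.smul_def, mul_one]
        exact (residue_eq_zero_iff a).2 ha
      rw [LinearMap.applyₗ_apply_apply, ← map_smul, this, map_zero]
  refine ⟨LinearEquiv.ofBijective e ⟨fun f g hfg => ?_, fun z => ?_⟩⟩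
  · have h1 : f 1 = g 1 := congrArg Subtype.val hfg
    ext y
    obtain ⟨y, rfl⟩ := IsLocalRing.residue_surjective y
    have : residue R y = y • (1 : ResidueField R) := by
      rw [Algebra.smul_def, mul_one]
      rfl
    rw [this, map_smul, map_smul, h1]
  · have hz := (Submodule.mem_torsionBySet_iff _ _).1 z.2
    refine ⟨(maximalIdeal R).liftQ (LinearMap.toSpanSingleton R N z.1) ?_, ?_⟩
    · intro a ha
      simpa using hz ⟨a, ha⟩
    · ext
      exact one_smul R z.1

lemma length_torsionBySet_maximalIdeal_ne_top [IsNoetherian R N] :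
    Module.length R (Submodule.torsionBySet R N (maximalIdeal R)) ≠ ⊤ := by
  let := Ideal.Quotient.field (maximalIdeal R)
  let W := Submodule.torsionBySet R N (maximalIdeal R)
  have : IsNoetherian (R ⧸ maximalIdeal R) W := isNoetherian_of_tower R inferInstance
  rw [Module.length_eq_of_surjective (S := R) (R := R ⧸ maximalIdeal R)
    Ideal.Quotient.mk_surjective]
  have : IsArtinian (R ⧸ maximalIdeal R) W := inferInstance
  exact Module.length_ne_top

lemma cmTypeAt_eq_length_torsionBySet {xs : List R} (hxs : ∀ x ∈ xs, x ∈ maximalIdeal R)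
    (h : RingTheory.Sequence.IsWeaklyRegular N xs) :
    cmTypeAt R N xs.length = Module.length R (Submodule.torsionBySet R
      (N ⧸ (Ideal.ofList xs • (⊤ : Submodule R N))) (maximalIdeal R)) := by
  obtain ⟨e⟩ := nonempty_extResidue_equiv hxs h
  obtain ⟨e'⟩ := nonempty_residueField_linearMap_equiv_torsionBySet (R := R)
    (N := N ⧸ (Ideal.ofList xs • (⊤ : Submodule R N)))
  rw [cmTypeAt, moduleLength, ← Module.coe_length, (e ≪≫ₗ e').length_eq]

end LocalRing

lemma length_eq_of_forall_exists_smul_eq {R A V : Type*} [Ring R] [Ring A] [AddCommGroup V]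
    [Module R V] [Module A V] (h : ∀ a : A, ∃ r : R, ∀ v : V, a • v = r • v)
    (h' : ∀ r : R, ∃ a : A, ∀ v : V, r • v = a • v) : Module.length A V = Module.length R V := by
  let e : Submodule A V ≃o Submodule R V :=
    { toFun := fun W =>
        { W with
          smul_mem' := fun r v hv => by
            obtain ⟨a, ha⟩ := h' r
            rw [ha]
            exact W.smul_mem a hv }
      invFun := fun W =>
        { W with
          smul_mem' := fun a v hv => by
            obtain ⟨r, hr⟩ := h a
            rw [hr]
            exact W.smul_mem r hv }
      left_inv := fun _ => rfl
      right_inv := fun _ => rfl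
      map_rel_iff' := Iff.rfl }
  apply WithBot.coe_injective
  rw [Module.coe_length, Module.coe_length, Order.krullDim_eq_of_orderIso e]

lemma length_eq_length_iff_surjective {R V W : Type*} [CommRing R] [AddCommGroup V] [Module R V]
    [AddCommGroup W] [Module R W] {f : V →ₗ[R] W} (hf : Function.Injective f)
    (hV : Module.length R V ≠ ⊤) :
    Module.length R W = Module.length R V ↔ Function.Surjective f := by
  rw [Module.length_eq_add_of_exact f f.range.mkQ hf f.range.mkQ_surjective
    (LinearMap.exact_map_mkQ_range f)]
  have h : Module.length R V + Module.length R (W ⧸ f.range) = Module.length R V + 0 ↔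
      Module.length R (W ⧸ f.range) = 0 := (ENat.add_right_injective_of_ne_top hV).eq_iff
  rw [add_zero] at h
  rw [h, Module.length_eq_zero_iff, Submodule.Quotient.subsingleton_iff,
    LinearMap.range_eq_top]

section TrivSqZeroExt

variable {R M : Type*} [CommRing R] [AddCommGroup M] [Module R M]

lemma TrivSqZeroExt.mem_ideal_smul_top_iff {I : Ideal R} {a : TrivSqZeroExt R M} :
    a ∈ I • (⊤ : Submodule R (TrivSqZeroExt R M)) ↔
      a.fst ∈ I ∧ a.snd ∈ I • (⊤ : Submodule R M) := by
  refine ⟨fun h => ?_, fun ⟨h1, h2⟩ => ?_⟩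
  · refine Submodule.smul_induction_on h (fun r hr b _ => ⟨?_, ?_⟩) fun b c hb hc => ⟨?_, ?_⟩
    · exact I.mul_mem_right _ hr
    · exact Submodule.smul_mem_smul hr trivial
    · exact I.add_mem hb.1 hc.1
    · exact add_mem hb.2 hc.2
  · rw [← inl_fst_add_inr_snd_eq a]
    refine add_mem ?_ ?_
    · have : (inl a.fst : TrivSqZeroExt R M) = a.fst • (1 : TrivSqZeroExt R M) := by
        ext <;> simp
      rw [this]
      exact Submodule.smul_mem_smul h1 trivial
    · have := Submodule.mem_map_of_mem (f := inrHom R M) h2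
      rw [Submodule.map_smul''] at this
      exact Submodule.smul_mono le_rfl le_top this

lemma TrivSqZeroExt.isWeaklyRegular {xs : List R} (hR : RingTheory.Sequence.IsWeaklyRegular R xs)
    (hM : RingTheory.Sequence.IsWeaklyRegular M xs) :
    RingTheory.Sequence.IsWeaklyRegular (TrivSqZeroExt R M) xs := by
  refine ⟨fun i hi => ?_⟩
  have h1 := hR.regular_mod_prev i hi
  have h2 := hM.regular_mod_prev i hi
  rw [isSMulRegular_quotient_iff_mem_of_smul_mem] at h1 h2 ⊢
  intro a ha
  rw [mem_ideal_smul_top_iff] at ha ⊢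
  exact ⟨by simpa using h1 a.fst (by simpa using ha.1), h2 a.snd ha.2⟩

variable [Module Rᵐᵒᵖ M] [IsCentralScalar R M]

lemma TrivSqZeroExt.mem_map_algebraMap_smul_top_iff {I : Ideal R} {a : TrivSqZeroExt R M} :
    a ∈ I.map (algebraMap R (TrivSqZeroExt R M)) •
        (⊤ : Submodule (TrivSqZeroExt R M) (TrivSqZeroExt R M)) ↔
      a.fst ∈ I ∧ a.snd ∈ I • (⊤ : Submodule R M) := by
  rw [← mem_ideal_smul_top_iff, smul_eq_mul, Ideal.mul_top, Ideal.smul_top_eq_map]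
  rfl

lemma TrivSqZeroExt.mem_maximalIdeal_iff [IsLocalRing R] {a : TrivSqZeroExt R M} :
    a ∈ maximalIdeal (TrivSqZeroExt R M) ↔ a.fst ∈ maximalIdeal R := by
  rw [mem_maximalIdeal, mem_maximalIdeal, mem_nonunits_iff, mem_nonunits_iff,
    isUnit_iff_isUnit_fst]

end TrivSqZeroExt

lemma le_of_pow_le_of_forall_mul_mem {R : Type*} [CommRing R] {I J Q : Ideal R} {n : ℕ}
    (hI : I ^ n ≤ Q) (h : ∀ r ∈ J, (∀ a ∈ I, a * r ∈ Q) → r ∈ Q) : J ≤ Q := by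
  have key (j : ℕ) : ∀ r ∈ J, (∀ a ∈ I ^ j, a * r ∈ Q) → r ∈ Q := by
    induction j with
    | zero => exact fun r _ h => by simpa using h 1 (by simp)
    | succ j ih =>
      refine fun r hr hrQ => h r hr fun a ha => ih _ (J.mul_mem_left a hr) fun b hb => ?_
      rw [← mul_assoc]
      exact hrQ _ (pow_succ I j ▸ Ideal.mul_mem_mul hb ha)
  exact fun r hr => key n r hr fun a ha => Q.mul_mem_right r (hI ha)

lemma mem_annihilator_quotient_smul_top_iff {R M : Type*} [CommRing R] [AddCommGroup M]
    [Module R M] {Q : Ideal R} {r : R} :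
    r ∈ Module.annihilator R (M ⧸ (Q • (⊤ : Submodule R M))) ↔
      ∀ m : M, r • m ∈ Q • (⊤ : Submodule R M) := by
  rw [Module.mem_annihilator, (Submodule.mkQ_surjective _).forall]
  refine forall_congr' fun m => ?_
  rw [← map_smul, Submodule.mkQ_apply, Submodule.Quotient.mk_eq_zero]

lemma annihilator_quotient_smul_top_eq_iff {R M : Type*} [CommRing R] [IsNoetherianRing R]
    [AddCommGroup M] [Module R M] {I Q : Ideal R} (hI : I ≤ Q.radical) :
    Module.annihilator R (M ⧸ (Q • (⊤ : Submodule R M))) = Q ↔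
      ∀ r, (∀ m : M, r • m ∈ Q • (⊤ : Submodule R M)) → (∀ a ∈ I, a * r ∈ Q) → r ∈ Q := by
  obtain ⟨n, hn⟩ := Ideal.exists_pow_le_of_le_radical_of_fg hI (IsNoetherian.noetherian I)
  refine ⟨fun h r hr _ => h ▸ mem_annihilator_quotient_smul_top_iff.2 hr, fun h => ?_⟩
  refine le_antisymm (le_of_pow_le_of_forall_mul_mem hn fun r hr =>
    h r (mem_annihilator_quotient_smul_top_iff.1 hr)) fun r hr => ?_
  exact mem_annihilator_quotient_smul_top_iff.2 fun m => Submodule.smul_mem_smul hr trivial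

section Socle

variable {R M : Type u} [CommRing R] [IsLocalRing R] [AddCommGroup M] [Module R M]

lemma mk_mem_torsionBySet_maximalIdeal_iff {P : Submodule R M} {m : M} :
    (Submodule.Quotient.mk m : M ⧸ P) ∈ Submodule.torsionBySet R (M ⧸ P) (maximalIdeal R) ↔
      ∀ a ∈ maximalIdeal R, a • m ∈ P := by
  rw [Submodule.mem_torsionBySet_iff, Subtype.forall]
  refine forall₂_congr fun a _ => ?_
  change a • (Submodule.Quotient.mk m : M ⧸ P) = 0 ↔ _
  rw [← Submodule.Quotient.mk_smul, Submodule.Quotient.mk_eq_zero]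

variable [Module Rᵐᵒᵖ M] [IsCentralScalar R M]

lemma TrivSqZeroExt.mk_mem_torsionBySet_maximalIdeal_iff {Q : Ideal R}
    {P : Ideal (TrivSqZeroExt R M)}
    (hP : ∀ a, a ∈ P ↔ a.fst ∈ Q ∧ a.snd ∈ Q • (⊤ : Submodule R M)) {a : TrivSqZeroExt R M} :
    (Submodule.Quotient.mk a : TrivSqZeroExt R M ⧸ P) ∈
        Submodule.torsionBySet (TrivSqZeroExt R M) (TrivSqZeroExt R M ⧸ P)
          (maximalIdeal (TrivSqZeroExt R M)) ↔
      ((∀ r ∈ maximalIdeal R, r * a.fst ∈ Q) ∧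
        ∀ m : M, a.fst • m ∈ Q • (⊤ : Submodule R M)) ∧
        ∀ r ∈ maximalIdeal R, r • a.snd ∈ Q • (⊤ : Submodule R M) := by
  rw [_root_.mk_mem_torsionBySet_maximalIdeal_iff]
  simp only [smul_eq_mul, hP, mem_maximalIdeal_iff, fst_mul, snd_mul, op_smul_eq_smul]
  refine ⟨fun h => ⟨⟨fun r hr => ?_, fun m => ?_⟩, fun r hr => ?_⟩, fun h b hb => ⟨?_, ?_⟩⟩
  · simpa using (h (inl r) (by simpa using hr)).1
  · simpa using (h (inr m) (by simp)).2
  · simpa using (h (inl r) (by simpa using hr)).2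
  · exact h.1.1 _ hb
  · exact add_mem (h.2 _ hb) (h.1.2 _)

lemma TrivSqZeroExt.length_torsionBySet_maximalIdeal_eq_iff [IsNoetherianRing R]
    [Module.Finite R M] {Q : Ideal R} {P : Ideal (TrivSqZeroExt R M)}
    (hP : ∀ a, a ∈ P ↔ a.fst ∈ Q ∧ a.snd ∈ Q • (⊤ : Submodule R M)) :
    Module.length (TrivSqZeroExt R M) (Submodule.torsionBySet (TrivSqZeroExt R M)
        (TrivSqZeroExt R M ⧸ P) (maximalIdeal (TrivSqZeroExt R M))) =
      Module.length R (Submodule.torsionBySet R (M ⧸ (Q • (⊤ : Submodule R M)))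
        (maximalIdeal R)) ↔
      ∀ r, (∀ m : M, r • m ∈ Q • (⊤ : Submodule R M)) →
        (∀ a ∈ maximalIdeal R, a * r ∈ Q) → r ∈ Q := by
  let S := Submodule.torsionBySet (TrivSqZeroExt R M) (TrivSqZeroExt R M ⧸ P)
    (maximalIdeal (TrivSqZeroExt R M))
  let g : (M ⧸ (Q • (⊤ : Submodule R M))) →ₗ[R] (TrivSqZeroExt R M ⧸ P) :=
    Submodule.liftQ _ (P.mkQ.restrictScalars R ∘ₗ inrHom R M) fun m hm => by
      exact (Submodule.Quotient.mk_eq_zero _).2 ((hP _).2 ⟨by simp, hm⟩)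
  have hg (m : M) : g (Submodule.Quotient.mk m) = Submodule.Quotient.mk (inr m) := rfl
  have hgS (z) (hz : z ∈ Submodule.torsionBySet R (M ⧸ (Q • (⊤ : Submodule R M)))
      (maximalIdeal R)) : g z ∈ S.restrictScalars R := by
    obtain ⟨m, rfl⟩ := Submodule.Quotient.mk_surjective _ z
    rw [hg]
    refine (mk_mem_torsionBySet_maximalIdeal_iff hP).2 ⟨?_, ?_⟩
    · simp
    · exact _root_.mk_mem_torsionBySet_maximalIdeal_iff.1 hz
  let f := g.restrict hgS
  have hg_inj : Function.Injective g := by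
    rw [injective_iff_map_eq_zero]
    intro z hz
    obtain ⟨m, rfl⟩ := Submodule.Quotient.mk_surjective _ z
    rw [hg, Submodule.Quotient.mk_eq_zero, hP] at hz
    exact (Submodule.Quotient.mk_eq_zero _).2 hz.2
  have hf : Function.Injective f := fun z w h => Subtype.ext (hg_inj (congrArg Subtype.val h))
  have hlen : Module.length (TrivSqZeroExt R M) S = Module.length R (S.restrictScalars R) := by
    refine length_eq_of_forall_exists_smul_eq (V := S) (fun a => ⟨a.fst, fun v => ?_⟩)
      fun r => ⟨algebraMap R _ r, fun v => Subtype.ext (algebraMap_smul _ r v.1).symm⟩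
    have hv := (Submodule.mem_torsionBySet_iff _ _).1 v.2
      ⟨inr a.snd, mem_maximalIdeal_iff.2 (by simp)⟩
    ext
    have : a • v.1 = (inl a.fst : TrivSqZeroExt R M) • v.1 +
        (inr a.snd : TrivSqZeroExt R M) • v.1 := by
      rw [← add_smul, inl_fst_add_inr_snd_eq]
    change a • v.1 = a.fst • v.1
    rw [this, ← algebraMap_smul (TrivSqZeroExt R M) a.fst v.1]
    exact add_eq_left.2 hv
  rw [hlen, length_eq_length_iff_surjective hf length_torsionBySet_maximalIdeal_ne_top]
  refine ⟨fun hsurj r hr hrQ => ?_, fun h => ?_⟩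
  · obtain ⟨⟨z, hz⟩, h⟩ := hsurj ⟨Submodule.Quotient.mk (inl r),
      (mk_mem_torsionBySet_maximalIdeal_iff hP).2 ⟨⟨by simpa using hrQ, by simpa using hr⟩,
        by simp⟩⟩
    obtain ⟨m, rfl⟩ := Submodule.Quotient.mk_surjective _ z
    have h : g (Submodule.Quotient.mk m) = Submodule.Quotient.mk (inl r) := congrArg Subtype.val h
    rw [hg, eq_comm, Submodule.Quotient.eq, hP] at h
    simpa using h.1
  · rintro ⟨z, hz⟩
    obtain ⟨a, rfl⟩ := Submodule.Quotient.mk_surjective _ z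
    obtain ⟨⟨h1, h2⟩, h3⟩ := (mk_mem_torsionBySet_maximalIdeal_iff hP).1 hz
    refine ⟨⟨Submodule.Quotient.mk a.snd, _root_.mk_mem_torsionBySet_maximalIdeal_iff.2 h3⟩,
      Subtype.ext ?_⟩
    change g (Submodule.Quotient.mk a.snd) = Submodule.Quotient.mk a
    rw [hg, eq_comm, Submodule.Quotient.eq, hP]
    simpa using h _ h2 h1

end Socle

/-- For `R` Cohen-Macaulay local, `M` maximal Cohen-Macaulay and `Q` a parameter ideal of
`R`, `r(R ⋉ M) = r_R(M)` iff `M/QM` is a faithful `R/Q`-module (equivalently, the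
`R`-annihilator of `M/QM` equals `Q`). -/
theorem cmType_idealization_eq_iff_faithful (R M : Type u) [CommRing R] [IsNoetherianRing R]
    [IsLocalRing R] [AddCommGroup M] [Module R M] [Module Rᵐᵒᵖ M] [IsCentralScalar R M]
    [Module.Finite R M] (d : ℕ) (hdim : ringKrullDim R = d) (hRCM : moduleDepth R R = d)
    (hMCM : moduleDepth R M = d) (Q : Ideal R) (hQ : IsParameterIdeal Q d) :
    cmTypeAt (TrivSqZeroExt R M) (TrivSqZeroExt R M) d = cmTypeAt R M d ↔
      Module.annihilator R (M ⧸ (Q • (⊤ : Submodule R M))) = Q := by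
  obtain ⟨s, rfl, hs, hrad⟩ := hQ
  have hQ : Ideal.span (s : Set R) = Ideal.ofList s.toList := by
    simp [Ideal.ofList, Finset.mem_toList]
  have hlen : s.toList.length = d := by rw [Finset.length_toList, hs]
  generalize s.toList = xs at hQ hlen
  rw [hQ] at hrad ⊢
  subst hlen
  have hxs (x) (hx : x ∈ xs) : x ∈ maximalIdeal R :=
    hrad ▸ Ideal.le_radical (Ideal.subset_span hx)
  have hprime (q : Ideal R) (hq : q.IsPrime) (hle : Ideal.ofList xs ≤ q) :
      q = maximalIdeal R :=
    le_antisymm (le_maximalIdeal hq.ne_top) (hrad ▸ hq.radical_le_iff.2 hle)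
  have hR : RingTheory.Sequence.IsWeaklyRegular R xs :=
    isWeaklyRegular_of_subsingleton_extResidue hxs (fun q hq _ hle => hprime q hq hle)
      fun i hi => subsingleton_extResidue_of_lt_moduleDepth (by rw [hRCM]; exact_mod_cast hi)
  have hM : RingTheory.Sequence.IsWeaklyRegular M xs :=
    isWeaklyRegular_of_subsingleton_extResidue hxs (fun q hq _ hle => hprime q hq hle)
      fun i hi => subsingleton_extResidue_of_lt_moduleDepth (by rw [hMCM]; exact_mod_cast hi)
  have hA := (RingTheory.Sequence.isWeaklyRegular_map_algebraMap_iff (S := TrivSqZeroExt R M)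
    (TrivSqZeroExt R M) xs).2 (TrivSqZeroExt.isWeaklyRegular hR hM)
  have hcmA := cmTypeAt_eq_length_torsionBySet (fun y hy => by
    obtain ⟨x, hx, rfl⟩ := List.mem_map.1 hy
    exact TrivSqZeroExt.mem_maximalIdeal_iff.2 (hxs x hx)) hA
  rw [List.length_map] at hcmA
  rw [hcmA, cmTypeAt_eq_length_torsionBySet hxs hM, WithBot.coe_inj,
    annihilator_quotient_smul_top_eq_iff hrad.ge]
  refine TrivSqZeroExt.length_torsionBySet_maximalIdeal_eq_iff fun a => ?_
  rw [← Ideal.map_ofList]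
  exact TrivSqZeroExt.mem_map_algebraMap_smul_top_iff
end

section
/- Let (R, 𝔪) be Cohen-Macaulay, M a maximal Cohen-Macaulay R-module, and Q a parameter ideal of R. Then r(R ⋉ M) = r(R) + r_R(M) if and only if (Q :_R 𝔪)M = QM. -/
universe u

open TrivSqZeroExt IsLocalRing


open TrivSqZeroExt

section ExtComparison

open CategoryTheory Abelian

namespace CategoryTheory.ProjectiveResolution

variable {R : Type u} [CommRing R] {X : ModuleCat.{u} R} (P : ProjectiveResolution X)
  (Y : ModuleCat.{u} R)

lemma smul_extMk {n : ℕ} (f : P.complex.X n ⟶ Y) (m : ℕ) (hm : n + 1 = m)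
    (hf : P.complex.d m n ≫ f = 0) (r : R) :
    P.extMk (r • f) m hm (by simp [hf]) = r • P.extMk f m hm hf := by
  rw [Ext.smul_eq_comp_mk₀, extMk_comp_mk₀]
  simp

lemma extMk_eq_zero_iff_zero (f : P.complex.X 0 ⟶ Y) (hf : P.complex.d 1 0 ≫ f = 0) :
    P.extMk f 1 rfl hf = 0 ↔ f = 0 := by
  simp only [← P.extEquivCohomologyClass.apply_eq_iff_eq,
    extEquivCohomologyClass_extMk, extEquivCohomologyClass_zero,
    CochainComplex.HomComplex.CohomologyClass.mk_eq_zero_iff]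
  rw [CochainComplex.HomComplex.Cocycle.toSingleMk_mem_coboundaries_iff _ _ _ _ _ 1 (by simp)]
  have h : Limits.IsZero (P.cochainComplex.X 1) := P.cochainComplex.isZero_of_isStrictlyLE 0 1
  refine ⟨fun ⟨g, hg⟩ ↦ ?_, fun hf ↦ ⟨0, by simp [hf]⟩⟩
  rw [h.eq_of_src g 0, Limits.comp_zero] at hg
  rw [← cancel_epi (P.cochainComplexXIso _ 0 rfl).hom]
  simpa using hg.symm

lemma mem_ker_linearYonedaObj_iff {n : ℕ} (f : P.complex.X n ⟶ Y) :
    f ∈ LinearMap.ker ((P.complex.linearYonedaObj R Y).sc n).g.hom ↔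
      P.complex.d (n + 1) n ≫ f = 0 := by
  change f ∈ LinearMap.ker
    ((P.complex.linearYonedaObj R Y).d n ((ComplexShape.up ℕ).next n)).hom ↔ _
  rw [CochainComplex.next]
  exact Iff.rfl

lemma mem_range_linearYonedaObj_iff {n : ℕ} (f : P.complex.X n ⟶ Y)
    (hf : P.complex.d (n + 1) n ≫ f = 0) :
    f ∈ LinearMap.range ((P.complex.linearYonedaObj R Y).sc n).f.hom ↔
      P.extMk f (n + 1) rfl hf = 0 := by
  change f ∈ LinearMap.range
    ((P.complex.linearYonedaObj R Y).d ((ComplexShape.up ℕ).prev n) n).hom ↔ _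
  cases n with
  | zero =>
    rw [HomologicalComplex.shape _ _ _ (by simp), P.extMk_eq_zero_iff_zero Y f hf]
    exact ⟨fun ⟨_, hg⟩ ↦ hg.symm, fun h ↦ ⟨0, h.symm⟩⟩
  | succ n =>
    rw [CochainComplex.prev_nat_succ, P.extMk_eq_zero_iff f _ rfl hf n rfl]
    exact Iff.rfl

/-- The class in `Ext X Y n` of a cocycle of `Hom(P, Y)`, where `P` is a projective
resolution of `X`. -/
noncomputable def cocyclesToExt (n : ℕ) :
    LinearMap.ker ((P.complex.linearYonedaObj R Y).sc n).g.hom →ₗ[R] Ext.{u} X Y n where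
  toFun f := P.extMk (Y := Y) f.1 (n + 1) rfl ((P.mem_ker_linearYonedaObj_iff Y _).1 f.2)
  map_add' _ _ := (P.add_extMk _ _ _ _ _ _).symm
  map_smul' r _ := P.smul_extMk Y _ _ _ _ r

lemma cocyclesToExt_surjective (n : ℕ) : Function.Surjective (P.cocyclesToExt Y n) := fun α ↦ by
  obtain ⟨f, hf, rfl⟩ := P.extMk_surjective α (n + 1) rfl
  exact ⟨⟨f, (P.mem_ker_linearYonedaObj_iff Y f).2 hf⟩, rfl⟩

lemma ker_cocyclesToExt (n : ℕ) :
    LinearMap.ker (P.cocyclesToExt Y n) =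
      LinearMap.range ((P.complex.linearYonedaObj R Y).sc n).moduleCatToCycles := by
  ext f
  refine (P.mem_range_linearYonedaObj_iff Y f.1
    ((P.mem_ker_linearYonedaObj_iff Y _).1 f.2)).symm.trans ?_
  exact ⟨fun ⟨g, hg⟩ ↦ ⟨g, Subtype.ext hg⟩, fun ⟨g, hg⟩ ↦ ⟨g, congrArg Subtype.val hg⟩⟩

/-- `Ext`, defined by deriving `Hom(-, Y)`, agrees with `Ext` defined by morphisms in the
derived category. -/
noncomputable def extLinearEquiv (n : ℕ) :
    ((_root_.Ext R (ModuleCat.{u} R) n).obj (Opposite.op X)).obj Y ≃ₗ[R] Ext.{u} X Y n :=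
  ((P.isoExt n Y).toLinearEquiv.trans
    ((P.complex.linearYonedaObj R Y).sc n).moduleCatHomologyIso.toLinearEquiv).trans
    ((Submodule.quotEquivOfEq _ _ (P.ker_cocyclesToExt Y n).symm).trans
      ((P.cocyclesToExt Y n).quotKerEquivOfSurjective (P.cocyclesToExt_surjective Y n)))

end CategoryTheory.ProjectiveResolution

end ExtComparison

section RegularSequences

open CategoryTheory Abelian RingTheory.Sequence Module

variable {R : Type u} [CommRing R]

/-- If `x` is `M`-regular and kills `K`, then the connecting morphism
`Ext^n(K, M/xM) → Ext^(n+1)(K, M)` is bijective as soon as `Ext^n(K, M) = 0`. -/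
lemma ext_quotSMulTop_equiv (K M : ModuleCat.{u} R) {x : R} (hx : x ∈ annihilator R K)
    (reg : IsSMulRegular M x) (n : ℕ) [Subsingleton (Ext.{u} K M n)] :
    Nonempty (Ext.{u} K (ModuleCat.of R (QuotSMulTop x M)) n ≃ₗ[R] Ext.{u} K M (n + 1)) := by
  have hS := reg.smulShortComplex_shortExact
  refine ⟨LinearEquiv.ofBijective (hS.extClass.postcompOfLinear R K rfl) ⟨?_, fun y ↦ ?_⟩⟩
  · rw [injective_iff_map_eq_zero]
    intro y hy
    obtain ⟨z, rfl⟩ := Ext.covariant_sequence_exact₃ K hS y rfl hy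
    obtain rfl : z = 0 := Subsingleton.elim (α := Ext.{u} K M n) z 0
    simp
  · refine Ext.covariant_sequence_exact₁ K hS y ?_ rfl
    exact congrArg (fun g ↦ g y)
      (Ext.postcomp_smul_id_eq_zero_of_mem_annihilator (M := M) hx (n + 1))

lemma ext_of_isWeaklyRegular (K : ModuleCat.{u} R) (rs : List R)
    (hK : ∀ r ∈ rs, r ∈ annihilator R K) (M : Type u) [AddCommGroup M] [Module R M]
    (reg : IsWeaklyRegular M rs) :
    (∀ i < rs.length, Subsingleton (Ext.{u} K (ModuleCat.of R M) i)) ∧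
      Nonempty (Ext.{u} K (ModuleCat.of R M) rs.length ≃ₗ[R]
        (K →ₗ[R] (M ⧸ (Ideal.ofList rs • (⊤ : Submodule R M))))) := by
  induction rs generalizing M with
  | nil =>
    refine ⟨fun i hi ↦ absurd hi (Nat.not_lt_zero i), ⟨?_⟩⟩
    refine (Ext.linearEquiv₀.trans ModuleCat.homLinearEquiv).trans (LinearEquiv.congrRight ?_)
    exact (Submodule.quotEquivOfEqBot _ (by simp)).symm
  | cons a rs ih =>
    rw [isWeaklyRegular_cons_iff] at reg
    simp only [List.mem_cons, forall_eq_or_imp] at hK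
    obtain ⟨vanish, ⟨e⟩⟩ := ih hK.2 (QuotSMulTop a M) reg.2
    have vanish' : ∀ i < rs.length + 1, Subsingleton (Ext.{u} K (ModuleCat.of R M) i) := by
      intro i
      induction i with
      | zero =>
        intro _
        have : Subsingleton (K →ₗ[R] M) := reg.1.linearMap_subsingleton_of_mem_annihilator hK.1
        exact (Ext.addEquiv₀.trans ModuleCat.homAddEquiv).subsingleton
      | succ i ih =>
        intro hi
        have := ih (by lia)
        obtain ⟨e⟩ := ext_quotSMulTop_equiv K (ModuleCat.of R M) hK.1 reg.1 i
        have := vanish i (by lia)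
        exact e.symm.toEquiv.subsingleton
    have := vanish' rs.length (by lia)
    obtain ⟨e'⟩ := ext_quotSMulTop_equiv K (ModuleCat.of R M) hK.1 reg.1 rs.length
    exact ⟨vanish', ⟨e'.symm.trans (e.trans (LinearEquiv.congrRight
      (Submodule.quotOfListConsSMulTopEquivQuotSMulTopInner M a rs).symm))⟩⟩

/-- Homomorphisms out of `R ⧸ I` are the elements killed by `I`. -/
noncomputable def linearMapQuotientEquivTorsionBySet (I : Ideal R) (M : Type*) [AddCommGroup M]
    [Module R M] : ((R ⧸ I) →ₗ[R] M) ≃ₗ[R] Submodule.torsionBySet R M (I : Set R) where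
  toFun f := ⟨f 1, (Submodule.mem_torsionBySet_iff _ _).2 fun a ↦ by
    change a.1 • f 1 = 0
    rw [← map_smul, Algebra.smul_def, mul_one]
    exact (congrArg f (Ideal.Quotient.eq_zero_iff_mem.2 a.2)).trans (map_zero f)⟩
  map_add' _ _ := rfl
  map_smul' _ _ := rfl
  invFun y := Submodule.liftQ I (LinearMap.toSpanSingleton R M y.1) fun a ha ↦
    (Submodule.mem_torsionBySet_iff _ _).1 y.2 ⟨a, ha⟩
  left_inv f := Submodule.linearMap_qext _ (LinearMap.ext_ring (one_smul R (f 1)))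
  right_inv y := Subtype.ext (one_smul R y.1)

lemma moduleLength_eq_length (M : Type*) [AddCommGroup M] [Module R M] :
    moduleLength R M = Module.length R M :=
  (Module.coe_length R M).symm

variable [IsLocalRing R]

lemma annihilator_residueField : annihilator R (ResidueField R) = maximalIdeal R :=
  Ideal.annihilator_quotient

/-- `extResidue` agrees with `Ext` defined by morphisms in the derived category. -/
noncomputable def extResidueEquiv (M : Type u) [AddCommGroup M] [Module R M] (n : ℕ) :
    extResidue R M n ≃ₗ[R]
      Ext.{u} (ModuleCat.of R (ResidueField R)) (ModuleCat.of R M) n :=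
  (projectiveResolution (ModuleCat.of R (ResidueField R))).extLinearEquiv (ModuleCat.of R M) n

/-- The type of a module is the length of the socle of its reduction modulo a regular
sequence. -/
lemma cmTypeAt_eq_length_socle (M : Type u) [AddCommGroup M] [Module R M] (rs : List R)
    (hrs : ∀ r ∈ rs, r ∈ maximalIdeal R) (reg : IsWeaklyRegular M rs) :
    cmTypeAt R M rs.length = Module.length R (Submodule.torsionBySet R
      (M ⧸ (Ideal.ofList rs • (⊤ : Submodule R M))) (maximalIdeal R : Set R)) := by
  obtain ⟨-, ⟨e⟩⟩ := ext_of_isWeaklyRegular (ModuleCat.of R (ResidueField R)) rs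
    (by simpa only [annihilator_residueField] using hrs) M reg
  rw [cmTypeAt, moduleLength_eq_length, LinearEquiv.length_eq ((extResidueEquiv M _).trans
    (e.trans (linearMapQuotientEquivTorsionBySet (maximalIdeal R) _)))]

lemma subsingleton_ext_of_lt_moduleDepth (M : Type u) [AddCommGroup M] [Module R M] {i : ℕ}
    (hi : i < moduleDepth R M) :
    Subsingleton (Ext.{u} (ModuleCat.of R (ResidueField R)) (ModuleCat.of R M) i) := by
  by_contra h
  rw [not_subsingleton_iff_nontrivial] at h
  exact (notMem_of_lt_csInf' hi) ⟨i, rfl, (extResidueEquiv M i).toEquiv.nontrivial⟩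

end RegularSequences

section SystemsOfParameters

open CategoryTheory Abelian RingTheory.Sequence Module

variable {R : Type u} [CommRing R] [IsNoetherianRing R] [IsLocalRing R]

/-- A regular sequence on `M` is no longer than the dimension of `R ⧸ p`, for every associated
prime `p` of `M`. -/
lemma length_le_ringKrullDim_quotient_of_mem_associatedPrimes (rs : List R)
    (hrs : ∀ r ∈ rs, r ∈ maximalIdeal R) (M : Type*) [AddCommGroup M] [Module R M]
    [Module.Finite R M] (reg : IsWeaklyRegular M rs) (p : Ideal R)
    (hp : p ∈ associatedPrimes R M) : (rs.length : WithBot ℕ∞) ≤ ringKrullDim (R ⧸ p) := by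
  induction rs generalizing M p with
  | nil =>
    have := hp.isPrime
    simpa using ringKrullDim_nonneg_of_nontrivial (R := R ⧸ p)
  | cons x rs ih =>
    rw [isWeaklyRegular_cons_iff] at reg
    simp only [List.mem_cons, forall_eq_or_imp] at hrs
    obtain ⟨hpp, m, hm⟩ := isAssociatedPrime_iff.1 hp
    have hmem (a : R) : a ∈ p ↔ a • m = 0 := by
      rw [hm, Submodule.mem_colon_singleton, Submodule.mem_bot]
    have hm0 : m ≠ 0 := fun h ↦ hpp.ne_top (Ideal.eq_top_iff_one _ |>.2 ((hmem 1).2 (by simp [h])))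
    have hxp : x ∉ p := fun h ↦ hm0 (reg.1 (by simpa using (hmem x).1 h))
    let N := Submodule.torsionBySet R M (p : Set R)
    have hmN : m ∈ N := (Submodule.mem_torsionBySet_iff _ _).2 fun a ↦ (hmem a.1).1 a.2
    let f : N →ₗ[R] QuotSMulTop x M := (Submodule.mkQ _).comp N.subtype
    have hf : Nontrivial (LinearMap.range f) := by
      rw [Submodule.nontrivial_iff_ne_bot, Ne, LinearMap.range_eq_bot]
      intro hf
      have hN : N ≤ maximalIdeal R • N := by
        intro n hn
        have : f ⟨n, hn⟩ = 0 := by rw [hf]; rfl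
        obtain ⟨m', -, rfl⟩ := (Submodule.Quotient.mk_eq_zero _).1 this
        refine Submodule.smul_mem_smul hrs.1 ((Submodule.mem_torsionBySet_iff _ _).2 fun a ↦ ?_)
        refine reg.1 ?_
        have := (Submodule.mem_torsionBySet_iff _ _).1 hn a
        simpa [smul_comm x] using this
      have := Submodule.eq_bot_of_le_smul_of_le_jacobson_bot _ N (IsNoetherian.noetherian N) hN
        (IsLocalRing.maximalIdeal_le_jacobson _)
      exact hm0 ((Submodule.mem_bot R).1 (this ▸ hmN))
    obtain ⟨q, hq⟩ := associatedPrimes.nonempty R (LinearMap.range f)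
    have hq' := associatedPrimes.subset_of_injective (LinearMap.range f).injective_subtype hq
    have hpq : p ≤ q := by
      refine le_trans (fun a ha ↦ ?_) hq.annihilator_le
      rw [Submodule.mem_annihilator]
      rintro ⟨_, n, rfl⟩ -
      refine Subtype.ext ?_
      change a • f n = 0
      rw [← map_smul, show a • n = 0 from
        Subtype.ext ((Submodule.mem_torsionBySet_iff _ _).1 n.2 ⟨a, ha⟩), map_zero]
    have hxq : x ∈ q := by
      refine hq'.annihilator_le ?_
      rw [Submodule.mem_annihilator]
      intro y _
      obtain ⟨y, rfl⟩ := Submodule.Quotient.mk_surjective _ y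
      exact (Submodule.Quotient.mk_eq_zero _).2 (Submodule.smul_mem_pointwise_smul y x ⊤ trivial)
    have := ih hrs.2 _ reg.2 q hq'
    have h2 := ringKrullDim_succ_le_of_surjective (Ideal.Quotient.factor hpq)
      (Ideal.Quotient.factor_surjective hpq) (r := Ideal.Quotient.mk p x)
      (mem_nonZeroDivisors_of_ne_zero (by rwa [Ne, Ideal.Quotient.eq_zero_iff_mem]))
      (by simpa [Ideal.Quotient.eq_zero_iff_mem] using hxq)
    refine le_trans ?_ h2
    simpa using add_le_add_left this 1

/-- The dimension of `R ⧸ p` is at most the number of elements generating an ideal that is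
`𝔪`-primary modulo `p`. -/
lemma ringKrullDim_quotient_le_length_s14 (p : Ideal R) [p.IsPrime] (rs : List R)
    (h : maximalIdeal R ≤ (Ideal.ofList rs ⊔ p).radical) (hrs : ∀ r ∈ rs, r ∈ maximalIdeal R) :
    ringKrullDim (R ⧸ p) ≤ rs.length := by
  classical
  have : IsLocalRing (R ⧸ p) := .of_surjective' _ Ideal.Quotient.mk_surjective
  have hmap : (maximalIdeal R).map (Ideal.Quotient.mk p) = maximalIdeal (R ⧸ p) :=
    map_maximalIdeal_of_surjective _ Ideal.Quotient.mk_surjective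
  let s := (rs.map (Ideal.Quotient.mk p)).toFinset
  have hs : Ideal.span (s : Set (R ⧸ p)) = (Ideal.ofList rs).map (Ideal.Quotient.mk p) := by
    rw [Ideal.map_ofList, Ideal.ofList]
    simp [s]
  have hmin : maximalIdeal (R ⧸ p) ∈ (Ideal.span (s : Set (R ⧸ p))).minimalPrimes := by
    rw [hs]
    refine ⟨⟨inferInstance, ?_⟩, fun J hJ _ ↦ ?_⟩
    · rw [← hmap]
      exact Ideal.map_mono (Ideal.span_le.2 hrs)
    · have := hJ.1
      have hc : (Ideal.ofList rs ⊔ p).radical ≤ J.comap (Ideal.Quotient.mk p) := by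
        refine (Ideal.IsPrime.radical_le_iff inferInstance).2 (sup_le ?_ fun a ha ↦ ?_)
        · exact Ideal.map_le_iff_le_comap.1 hJ.2
        · simp [Ideal.mem_comap, Ideal.Quotient.eq_zero_iff_mem.2 ha]
      rw [← hmap, Ideal.map_le_iff_le_comap]
      exact h.trans hc
  rw [← maximalIdeal_height_eq_ringKrullDim]
  have := Ideal.height_le_card_of_mem_minimalPrimes_span_finset hmin
  have h2 : s.card ≤ rs.length := (List.toFinset_card_le _).trans (by simp)
  exact_mod_cast this.trans (by exact_mod_cast h2)

/-- If `Ext^i(k, M)` vanishes below the length of a list generating an ideal that is `𝔪`-primary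
modulo the annihilator of `M`, then that list is a regular sequence on `M`. -/
lemma isWeaklyRegular_of_subsingleton_ext (rs : List R) (hrs : ∀ r ∈ rs, r ∈ maximalIdeal R)
    (M : Type u) [AddCommGroup M] [Module R M] [Module.Finite R M] [Nontrivial M]
    (hrad : maximalIdeal R ≤ (Ideal.ofList rs ⊔ annihilator R M).radical)
    (hext : ∀ i < rs.length,
      Subsingleton (Ext.{u} (ModuleCat.of R (ResidueField R)) (ModuleCat.of R M) i)) :
    IsWeaklyRegular M rs := by
  induction rs generalizing M with
  | nil => exact IsWeaklyRegular.nil R M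
  | cons x rs ih =>
    have reg : IsSMulRegular M x := by
      by_contra hx
      have : x ∈ ⋃ p ∈ associatedPrimes R M, (p : Set R) := by
        rw [biUnion_associatedPrimes_eq_compl_regular]
        exact hx
      simp only [Set.mem_iUnion, SetLike.mem_coe] at this
      obtain ⟨p, hp, hxp⟩ := this
      have := hp.isPrime
      have hle : ringKrullDim (R ⧸ p) ≤ rs.length := by
        refine ringKrullDim_quotient_le_length_s14 p rs (hrad.trans (Ideal.radical_mono ?_))
          fun r hr ↦ hrs r (List.mem_cons_of_mem _ hr)
        rw [Ideal.ofList_cons]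
        refine sup_le (sup_le (le_trans ?_ le_sup_right) le_sup_left) (le_trans ?_ le_sup_right)
        · rwa [Ideal.span_singleton_le_iff_mem]
        · simpa [Submodule.annihilator_top] using hp.annihilator_le
      obtain ⟨ys, hlen, hys, hreg⟩ := ModuleCat.exists_isRegular_of_exists_subsingleton_ext
        (maximalIdeal R) (rs.length + 1) (ModuleCat.of R M)
        (lt_top_iff_ne_top.2 fun h ↦ (Submodule.top_ne_ideal_smul_of_le_jacobson_annihilator
          (IsLocalRing.maximalIdeal_le_jacobson _)) h.symm)
        (ModuleCat.of R (ResidueField R))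
        (by rw [support_eq_zeroLocus]; congr 1; exact congrArg _ annihilator_residueField)
        hext
      have := (length_le_ringKrullDim_quotient_of_mem_associatedPrimes ys hys M
        hreg.toIsWeaklyRegular p hp).trans hle
      rw [hlen] at this
      have : rs.length + 1 ≤ rs.length := by exact_mod_cast this
      lia
    have hx := hrs x List.mem_cons_self
    have : Nontrivial (QuotSMulTop x M) := nontrivial_quotSMulTop_of_mem_maximalIdeal M hx
    rw [isWeaklyRegular_cons_iff]
    refine ⟨reg, ih (fun r hr ↦ hrs r (List.mem_cons_of_mem _ hr)) _
      (hrad.trans (Ideal.radical_mono ?_)) fun i hi ↦ ?_⟩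
    · rw [Ideal.ofList_cons]
      refine sup_le (sup_le (le_trans ?_ le_sup_right) le_sup_left) (le_trans ?_ le_sup_right)
      · rw [Ideal.span_singleton_le_iff_mem, mem_annihilator]
        intro y
        obtain ⟨y, rfl⟩ := Submodule.Quotient.mk_surjective _ y
        exact (Submodule.Quotient.mk_eq_zero _).2 (Submodule.smul_mem_pointwise_smul y x ⊤ trivial)
      · exact LinearMap.annihilator_le_of_surjective _ (Submodule.mkQ_surjective _)
    · have := hext i (by simp; lia)
      obtain ⟨e⟩ := ext_quotSMulTop_equiv (ModuleCat.of R (ResidueField R)) (ModuleCat.of R M)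
        (by rwa [annihilator_residueField]) reg i
      have := hext (i + 1) (by simpa using hi)
      exact e.toEquiv.subsingleton

end SystemsOfParameters

section Idealization

open RingTheory.Sequence Module Submodule

lemma mk_mem_torsionBySet_iff {R M : Type*} [CommRing R] [IsLocalRing R] [AddCommGroup M]
    [Module R M] (N : Submodule R M) (m : M) :
    (Submodule.Quotient.mk m : M ⧸ N) ∈ torsionBySet R _ (maximalIdeal R : Set R) ↔
      ∀ a ∈ maximalIdeal R, a • m ∈ N := by
  simp only [mem_torsionBySet_iff, Subtype.forall, SetLike.mem_coe,
    ← Submodule.Quotient.mk_smul, Submodule.Quotient.mk_eq_zero]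

lemma isArtinian_torsionBySet_maximalIdeal {R : Type*} [CommRing R] [IsNoetherianRing R]
    [IsLocalRing R] (N : Type*) [AddCommGroup N] [Module R N] [Module.Finite R N] :
    IsArtinian R (torsionBySet R N (maximalIdeal R : Set R)) := by
  let := (torsionBySet_isTorsionBySet (M := N) (maximalIdeal R : Set R)).module
  let := Ideal.Quotient.field (maximalIdeal R)
  have := (torsionBySet_isTorsionBySet (M := N) (maximalIdeal R : Set R)).isScalarTower (S := R)
  have : IsNoetherian (R ⧸ maximalIdeal R) (torsionBySet R N (maximalIdeal R : Set R)) :=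
    isNoetherian_of_tower R inferInstance
  have h : Module.length R (torsionBySet R N (maximalIdeal R : Set R)) ≠ ⊤ := by
    rw [Module.length_eq_of_surjective (R := R ⧸ maximalIdeal R) Ideal.Quotient.mk_surjective]
    exact Module.length_ne_top
  exact (isFiniteLength_iff_isNoetherian_isArtinian.1 (Module.length_ne_top_iff.1 h)).2

variable {R M : Type*} [CommRing R] [AddCommGroup M] [Module R M] [Module Rᵐᵒᵖ M]
  [IsCentralScalar R M]

/-- The extension of an ideal `I` of `R` to the idealization is `I × I M`. -/
lemma mem_map_algebraMap_idealization_iff (I : Ideal R) (z : TrivSqZeroExt R M) :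
    z ∈ I.map (algebraMap R (TrivSqZeroExt R M)) ↔
      z.fst ∈ I ∧ z.snd ∈ I • (⊤ : Submodule R M) := by
  constructor
  · intro hz
    have : I.map (algebraMap R (TrivSqZeroExt R M)) ≤ idealProd I (I • (⊤ : Submodule R M))
        fun a ha m ↦ smul_mem_smul ha trivial := by
      refine Ideal.map_le_iff_le_comap.2 fun a ha ↦ ⟨?_, ?_⟩
      · simpa [TrivSqZeroExt.algebraMap_eq_inl] using ha
      · simp [TrivSqZeroExt.algebraMap_eq_inl]
    exact this hz
  · rintro ⟨h₁, h₂⟩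
    rw [← inl_fst_add_inr_snd_eq z]
    refine add_mem (Ideal.mem_map_of_mem _ h₁) ?_
    generalize z.snd = m at h₂
    induction h₂ using smul_induction_on' with
    | smul a ha m _ =>
      rw [← inl_mul_inr]
      exact Ideal.mul_mem_right _ _ (Ideal.mem_map_of_mem _ ha)
    | add x _ y _ hx hy =>
      rw [inr_add]
      exact add_mem hx hy

/-- A sequence that is regular on `R` and on `M` is regular on the idealization. -/
lemma isWeaklyRegular_idealization (rs : List R) (hR : IsWeaklyRegular R rs)
    (hM : IsWeaklyRegular M rs) :
    IsWeaklyRegular (TrivSqZeroExt R M) (rs.map (algebraMap R (TrivSqZeroExt R M))) := by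
  refine ⟨fun i hi ↦ ?_⟩
  rw [List.length_map] at hi
  have hR := hR.regular_mod_prev i hi
  have hM := hM.regular_mod_prev i hi
  rw [isSMulRegular_quotient_iff_mem_of_smul_mem] at hR hM ⊢
  intro z
  rw [← List.map_take, ← Ideal.map_ofList, smul_eq_mul, Ideal.mul_top,
    mem_map_algebraMap_idealization_iff, mem_map_algebraMap_idealization_iff, List.getElem_map]
  rintro ⟨h₁, h₂⟩
  refine ⟨?_, hM _ ?_⟩
  · simpa using hR z.fst (by simpa [TrivSqZeroExt.algebraMap_eq_inl] using h₁)
  · simpa [TrivSqZeroExt.algebraMap_eq_inl] using h₂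

variable [IsLocalRing R]

lemma mem_maximalIdeal_idealization_iff (z : TrivSqZeroExt R M) :
    z ∈ maximalIdeal (TrivSqZeroExt R M) ↔ z.fst ∈ maximalIdeal R := by
  rw [mem_maximalIdeal, mem_maximalIdeal, mem_nonunits_iff, mem_nonunits_iff,
    isUnit_iff_isUnit_fst]

/-- The socle of a module over the idealization has the same length over `R`. -/
lemma length_torsionBySet_idealization (T : Type*) [AddCommGroup T] [Module R T]
    [Module (TrivSqZeroExt R M) T] [IsScalarTower R (TrivSqZeroExt R M) T] :
    Module.length (TrivSqZeroExt R M)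
      (torsionBySet (TrivSqZeroExt R M) T (maximalIdeal (TrivSqZeroExt R M) : Set _)) =
    Module.length R
      (torsionBySet (TrivSqZeroExt R M) T (maximalIdeal (TrivSqZeroExt R M) : Set _)) := by
  let W := torsionBySet (TrivSqZeroExt R M) T (maximalIdeal (TrivSqZeroExt R M) : Set _)
  have key (s : TrivSqZeroExt R M) (w : W) : s • w = s.fst • w := by
    have h : (inr s.snd : TrivSqZeroExt R M) • w = 0 := Subtype.ext <|
      (mem_torsionBySet_iff _ _).1 w.2 ⟨inr s.snd, by
        simp [mem_maximalIdeal_idealization_iff, -mem_maximalIdeal]⟩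
    conv_lhs => rw [← inl_fst_add_inr_snd_eq s, add_smul, h, add_zero]
    exact algebraMap_smul (TrivSqZeroExt R M) s.fst w
  refine WithBot.coe_injective ?_
  rw [Module.coe_length, Module.coe_length]
  refine Order.krullDim_eq_of_orderIso (β := Submodule R W)
    { toFun := restrictScalars R
      invFun N := { N.toAddSubmonoid with
        smul_mem' s w hw := by
          rw [key]
          exact N.smul_mem _ hw }
      left_inv _ := rfl
      right_inv _ := rfl
      map_rel_iff' := Iff.rfl }

/-- The socle of `(R ⋉ M) ⧸ I (R ⋉ M)`, in coordinates. -/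
lemma mk_mem_torsionBySet_idealization_iff (I : Ideal R) (z : TrivSqZeroExt R M) :
    (Submodule.Quotient.mk z : TrivSqZeroExt R M ⧸
        (I.map (algebraMap R (TrivSqZeroExt R M)) • (⊤ : Submodule (TrivSqZeroExt R M) _))) ∈
      torsionBySet (TrivSqZeroExt R M) _ (maximalIdeal (TrivSqZeroExt R M) : Set _) ↔
    (∀ a ∈ maximalIdeal R, a * z.fst ∈ I ∧ a • z.snd ∈ I • (⊤ : Submodule R M)) ∧
      ∀ m : M, z.fst • m ∈ I • (⊤ : Submodule R M) := by
  have h (s : TrivSqZeroExt R M) : s • (Submodule.Quotient.mk z : TrivSqZeroExt R M ⧸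
      (I.map (algebraMap R (TrivSqZeroExt R M)) • (⊤ : Submodule (TrivSqZeroExt R M) _))) = 0 ↔
      s.fst * z.fst ∈ I ∧ s.fst • z.snd + z.fst • s.snd ∈ I • (⊤ : Submodule R M) := by
    rw [← Submodule.Quotient.mk_smul, Submodule.Quotient.mk_eq_zero, smul_eq_mul, smul_eq_mul,
      Ideal.mul_top, mem_map_algebraMap_idealization_iff, fst_mul, snd_mul, op_smul_eq_smul]
  simp only [mem_torsionBySet_iff, Subtype.forall, SetLike.mem_coe,
    mem_maximalIdeal_idealization_iff, h]
  refine ⟨fun H ↦ ⟨fun a ha ↦ by simpa using H (inl a) (by simpa using ha), fun m ↦ by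
    simpa using H (inr m) (by simp [-mem_maximalIdeal])⟩, fun H s hs ↦ ?_⟩
  exact ⟨(H.1 _ hs).1, add_mem (H.1 _ hs).2 (H.2 _)⟩

/-- The length of the socle of `(R ⋉ M) ⧸ I (R ⋉ M)` is the sum of the lengths of the socles of
`R ⧸ I` and `M ⧸ I M` if and only if `(I : 𝔪) M = I M`. -/
theorem length_torsionBySet_idealization_eq_add_iff [IsNoetherianRing R] [Module.Finite R M]
    (I : Ideal R) :
    Module.length (TrivSqZeroExt R M) (torsionBySet (TrivSqZeroExt R M)
        (TrivSqZeroExt R M ⧸ (I.map (algebraMap R (TrivSqZeroExt R M)) •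
          (⊤ : Submodule (TrivSqZeroExt R M) (TrivSqZeroExt R M))))
        (maximalIdeal (TrivSqZeroExt R M) : Set _)) =
      Module.length R (torsionBySet R (R ⧸ (I • (⊤ : Submodule R R))) (maximalIdeal R : Set R)) +
      Module.length R (torsionBySet R (M ⧸ (I • (⊤ : Submodule R M))) (maximalIdeal R : Set R)) ↔
    (colon (I : Submodule R R) (maximalIdeal R : Submodule R R) : Ideal R) •
      (⊤ : Submodule R M) = I • (⊤ : Submodule R M) := by
  let P := I.map (algebraMap R (TrivSqZeroExt R M)) •
    (⊤ : Submodule (TrivSqZeroExt R M) (TrivSqZeroExt R M))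
  let W := torsionBySet (TrivSqZeroExt R M) (TrivSqZeroExt R M ⧸ P)
    (maximalIdeal (TrivSqZeroExt R M) : Set _)
  let V := torsionBySet R (M ⧸ (I • (⊤ : Submodule R M))) (maximalIdeal R : Set R)
  let X := torsionBySet R (R ⧸ (I • (⊤ : Submodule R R))) (maximalIdeal R : Set R)
  have hP (z : TrivSqZeroExt R M) : z ∈ P ↔ z.fst ∈ I ∧ z.snd ∈ I • (⊤ : Submodule R M) := by
    rw [← mem_map_algebraMap_idealization_iff, ← Ideal.mul_top (I.map _)]; rfl
  have hI (r : R) : r ∈ I • (⊤ : Submodule R R) ↔ r ∈ I := by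
    rw [smul_eq_mul, Ideal.mul_top]
  let φ : (M ⧸ (I • (⊤ : Submodule R M))) →ₗ[R] (TrivSqZeroExt R M ⧸ P) :=
    liftQ _ ((P.mkQ.restrictScalars R).comp (inrHom R M)) fun m hm ↦
      (Submodule.Quotient.mk_eq_zero _).2 ((hP _).2 ⟨by simp, by simpa using hm⟩)
  let ψ : (TrivSqZeroExt R M ⧸ P) →ₗ[R] (R ⧸ (I • (⊤ : Submodule R R))) :=
    (mapQ (P.restrictScalars R) (I • (⊤ : Submodule R R)) (fstHom R R M).toLinearMap fun z hz ↦
      (hI _).2 ((hP _).1 hz).1).comp (Submodule.Quotient.restrictScalarsEquiv R P).symm.toLinearMap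
  have hφW (v : V) : φ v ∈ W.restrictScalars R := by
    obtain ⟨v, hv⟩ := v
    obtain ⟨m, rfl⟩ := Submodule.Quotient.mk_surjective _ v
    refine (mk_mem_torsionBySet_idealization_iff I _).2 ⟨fun a ha ↦ ⟨by simp, ?_⟩, by simp⟩
    simpa using (mk_mem_torsionBySet_iff _ _).1 hv a ha
  have hψX (w : W.restrictScalars R) : ψ w ∈ X := by
    obtain ⟨w, hw⟩ := w
    obtain ⟨z, rfl⟩ := Submodule.Quotient.mk_surjective _ w
    refine (mk_mem_torsionBySet_iff _ _).2 fun a ha ↦ (hI _).2 ?_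
    exact (((mk_mem_torsionBySet_idealization_iff I _).1 hw).1 a ha).1
  let f : V →ₗ[R] W.restrictScalars R := (φ.comp V.subtype).codRestrict _ hφW
  let g : W.restrictScalars R →ₗ[R] X :=
    (ψ.comp (W.restrictScalars R).subtype).codRestrict _ hψX
  have hf : Function.Injective f := by
    rw [injective_iff_map_eq_zero]
    rintro ⟨v, hv⟩ h
    obtain ⟨m, rfl⟩ := Submodule.Quotient.mk_surjective _ v
    have := (hP _).1 ((Submodule.Quotient.mk_eq_zero _).1 (congrArg Subtype.val h))
    exact Subtype.ext ((Submodule.Quotient.mk_eq_zero _).2 (by simpa using this.2))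
  have hfg : Function.Exact f g.rangeRestrict := by
    rintro ⟨w, hw⟩
    obtain ⟨z, rfl⟩ := Submodule.Quotient.mk_surjective _ w
    constructor
    · intro h
      have hz := (hI _).1 ((Submodule.Quotient.mk_eq_zero _).1
        (congrArg Subtype.val (congrArg Subtype.val h)))
      refine ⟨⟨Submodule.Quotient.mk z.snd, (mk_mem_torsionBySet_iff _ _).2 fun a ha ↦
        (((mk_mem_torsionBySet_idealization_iff I _).1 hw).1 a ha).2⟩, Subtype.ext ?_⟩
      refine (Submodule.Quotient.eq _).2 ((hP _).2 ⟨?_, by simp⟩)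
      simpa using hz
    · rintro ⟨⟨v, hv⟩, h⟩
      obtain ⟨m, rfl⟩ := Submodule.Quotient.mk_surjective _ v
      have := (hP _).1 ((Submodule.Quotient.eq _).1 (congrArg Subtype.val h))
      refine Subtype.ext (Subtype.ext ((Submodule.Quotient.mk_eq_zero _).2 ((hI _).2 ?_)))
      simpa using this.1
  have hlen : Module.length R (W.restrictScalars R) =
      Module.length R V + Module.length R (LinearMap.range g) :=
    Module.length_eq_add_of_exact f g.rangeRestrict hf g.surjective_rangeRestrict hfg
  have hV : Module.length R V ≠ ⊤ :=
    have := isArtinian_torsionBySet_maximalIdeal (R := R) (M ⧸ (I • (⊤ : Submodule R M)))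
    Module.length_ne_top
  have hX : IsArtinian R X := isArtinian_torsionBySet_maximalIdeal _
  have hg : Module.length R (LinearMap.range g) = Module.length R X ↔ LinearMap.range g = ⊤ :=
    ⟨fun h ↦ by_contra fun h' ↦ (length_lt h').ne h, fun h ↦ by rw [h, Module.length_top]⟩
  rw [length_torsionBySet_idealization, show Module.length R W = _ from hlen, add_comm,
    (ENat.add_left_injective_of_ne_top hV).eq_iff, hg, LinearMap.range_eq_top]
  constructor
  · intro hsurj
    refine le_antisymm (smul_le.2 fun r hr m _ ↦ ?_) (smul_mono_left fun a ha ↦ ?_)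
    · obtain ⟨⟨w, hw⟩, h⟩ := hsurj ⟨Submodule.Quotient.mk r, (mk_mem_torsionBySet_iff _ _).2
        fun a ha ↦ (hI _).2 (by simpa [mul_comm] using mem_colon.1 hr a ha)⟩
      obtain ⟨z, rfl⟩ := Submodule.Quotient.mk_surjective _ w
      have h₁ := (hI _).1 ((Submodule.Quotient.eq _).1 (congrArg Subtype.val h))
      have h₂ := ((mk_mem_torsionBySet_idealization_iff I _).1 hw).2 m
      have := sub_mem h₂ (smul_mem_smul h₁ (mem_top (x := m)))
      simpa [← sub_smul] using this
    · exact mem_colon.2 fun b _ ↦ Ideal.mul_mem_right _ _ ha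
  · rintro h ⟨x, hx⟩
    obtain ⟨r, rfl⟩ := Submodule.Quotient.mk_surjective _ x
    have hr (a : R) (ha : a ∈ maximalIdeal R) : a * r ∈ I :=
      (hI _).1 ((mk_mem_torsionBySet_iff _ _).1 hx a ha)
    refine ⟨⟨Submodule.Quotient.mk (inl r), (mk_mem_torsionBySet_idealization_iff I _).2
      ⟨fun a ha ↦ ⟨hr a ha, by simp⟩, fun m ↦ h ▸ smul_mem_smul ?_ trivial⟩⟩, rfl⟩
    exact mem_colon.2 fun a ha ↦ by simpa [mul_comm] using hr a ha

end Idealization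

section ParameterIdeals

open RingTheory.Sequence Module

/-- If the depth of `M` is the dimension of `R`, then every system of parameters of `R` is
a regular sequence on `M`. -/
lemma isWeaklyRegular_of_moduleDepth_eq {R : Type u} [CommRing R] [IsNoetherianRing R]
    [IsLocalRing R] (M : Type u) [AddCommGroup M] [Module R M] [Module.Finite R M] (rs : List R)
    (hM : moduleDepth R M = rs.length) (hrad : (Ideal.ofList rs).radical = maximalIdeal R) :
    IsWeaklyRegular M rs := by
  cases subsingleton_or_nontrivial M
  · exact ⟨fun i _ ↦ Function.injective_of_subsingleton _⟩
  refine isWeaklyRegular_of_subsingleton_ext rs (fun r hr ↦ ?_) M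
    (hrad.ge.trans (Ideal.radical_mono le_sup_left)) fun i hi ↦
      subsingleton_ext_of_lt_moduleDepth M ?_
  · exact hrad ▸ Ideal.le_radical (Ideal.subset_span hr)
  · rw [hM]
    exact_mod_cast hi

end ParameterIdeals

/-- For `R` Cohen-Macaulay local, `M` maximal Cohen-Macaulay and `Q` a parameter ideal of
`R`, `r(R ⋉ M) = r(R) + r_R(M)` iff `(Q :_R 𝔪)M = QM`. -/
theorem cmType_idealization_eq_sum_iff (R M : Type u) [CommRing R] [IsNoetherianRing R]
    [IsLocalRing R] [AddCommGroup M] [Module R M] [Module Rᵐᵒᵖ M] [IsCentralScalar R M]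
    [Module.Finite R M] (d : ℕ) (hdim : ringKrullDim R = d) (hRCM : moduleDepth R R = d)
    (hMCM : moduleDepth R M = d) (Q : Ideal R) (hQ : IsParameterIdeal Q d) :
    cmTypeAt (TrivSqZeroExt R M) (TrivSqZeroExt R M) d = cmTypeAt R R d + cmTypeAt R M d ↔
      (Submodule.colon (Q : Submodule R R) (IsLocalRing.maximalIdeal R : Submodule R R) :
            Ideal R) • (⊤ : Submodule R M) =
        Q • (⊤ : Submodule R M) := by
  obtain ⟨s, rfl, rfl, hrad⟩ := hQ
  have hs : Ideal.span (s : Set R) = Ideal.ofList s.toList := by simp [Ideal.ofList]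
  rw [← s.length_toList] at hRCM hMCM ⊢
  rw [hs] at hrad ⊢
  have hmem (r : R) (hr : r ∈ s.toList) : r ∈ maximalIdeal R :=
    hrad ▸ Ideal.le_radical (Ideal.subset_span hr)
  have hR := isWeaklyRegular_of_moduleDepth_eq R s.toList hRCM hrad
  have hM := isWeaklyRegular_of_moduleDepth_eq M s.toList hMCM hrad
  have hS := cmTypeAt_eq_length_socle (TrivSqZeroExt R M) _ (by
    intro z hz
    obtain ⟨r, hr, rfl⟩ := List.mem_map.1 hz
    exact (mem_maximalIdeal_idealization_iff _).2 (hmem r hr))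
    (isWeaklyRegular_idealization _ hR hM)
  rw [List.length_map, ← Ideal.map_ofList] at hS
  rw [hS, cmTypeAt_eq_length_socle R _ hmem hR, cmTypeAt_eq_length_socle M _ hmem hM,
    ← length_torsionBySet_idealization_eq_add_iff (M := M) (Ideal.ofList s.toList),
    ← WithBot.coe_add, WithBot.coe_inj]
end
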